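/- Let d ≥ 2 and let f ∈ C^{0,1}((0,∞)) be non-increasing on (0,t₀] for some t₀ > 0. Then any nonnegative continuous viscosity solution u of Ψ(−Δ)u = f(u) in ℝ^d with lim_{|x|→∞} u(x) = 0 is radially symmetric up to translation; moreover, either u ≡ 0 or, up to translation, u is strictly decreasing in the radial direction. -/

import Mathlib

open MeasureTheory Set Filter Metric Asymptotics
open scoped RealInnerProductSpace ENNReal Topology NNReal

noncomputable section

abbrev Rd (d : ℕ) := EuclideanSpace ℝ (Fin d)

/-- The data of a Bernstein function `Ψ` vanishing at `0`, its Lévy measure `𝔪`,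
and the weak scaling conditions. -/
structure PsiSetting (d : ℕ) where
  Ψ : ℝ → ℝ
  m : Measure ℝ
  m_onIoi : m (Set.Iic 0) = 0
  smooth : ContDiffOn ℝ (⊤ : ℕ∞) Ψ (Set.Ioi 0)
  nonneg : ∀ x > (0:ℝ), 0 ≤ Ψ x
  deriv_alt : ∀ n : ℕ, ∀ x > (0:ℝ),
    (-1 : ℝ) ^ (n + 1) * iteratedDerivWithin (n + 1) Ψ (Set.Ioi 0) x ≤ 0
  zero_lim : Filter.Tendsto Ψ (nhdsWithin 0 (Set.Ioi 0)) (nhds 0)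
  levy_rep : ∀ lam > (0:ℝ), Ψ lam = ∫ t, (1 - Real.exp (-lam * t)) ∂m
  a₁ : ℝ
  a₂ : ℝ
  b₁ : ℝ
  b₂ : ℝ
  ha₁ : 0 < a₁
  ha₁₂ : a₁ ≤ a₂
  ha₂ : a₂ < 1
  hb₁ : 1 ≤ b₁
  hb₂ : 1 < b₂
  scaling_lower : ∀ r R : ℝ, 1 ≤ r → r ≤ R → (1 / b₁) * (R / r) ^ a₁ ≤ Ψ R / Ψ r
  scaling_upper : ∀ r R : ℝ, 1 ≤ r → r ≤ R → Ψ R / Ψ r ≤ b₁ * (R / r) ^ a₂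

/-- The jump kernel `j(r) = ∫_0^∞ (4πt)^{-d/2} e^{-r²/(4t)} 𝔪(dt)`. -/
def PsiSetting.j {d : ℕ} (S : PsiSetting d) (r : ℝ) : ℝ :=
  ∫ t, (4 * Real.pi * t) ^ (-(d : ℝ) / 2) * Real.exp (-(r ^ 2) / (4 * t)) ∂S.m

/-- The condition `j(r) ≤ b₂ j(r+1)` for `r ≥ 1`. -/
def PsiSetting.kernelCond {d : ℕ} (S : PsiSetting d) : Prop :=
  ∀ r : ℝ, 1 ≤ r → S.j r ≤ S.b₂ * S.j (r + 1)

/-- The nonlocal operator `Ψ(−Δ)` applied to a test function. -/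
def psiOp {d : ℕ} (S : PsiSetting d) (φ : Rd d → ℝ) (x : Rd d) : ℝ :=
  ∫ z : Rd d,
    (φ x - φ (x + z) + (if ‖z‖ ≤ 1 then ⟪z, gradient φ x⟫ else 0)) * S.j ‖z‖

/-- Admissible test functions at `x`: bounded continuous and C² near `x`. -/
def TestAt {d : ℕ} (x : Rd d) (φ : Rd d → ℝ) : Prop :=
  (∃ M, ∀ y, |φ y| ≤ M) ∧ Continuous φ ∧ ∃ U ∈ nhds x, ContDiffOn ℝ 2 φ U

/-- Viscosity supersolution of `Ψ(−Δ)u + c·u = g` in `Ω`. -/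
def IsSuperSol {d : ℕ} (S : PsiSetting d) (Ω : Set (Rd d)) (c g u : Rd d → ℝ) : Prop :=
  LowerSemicontinuous u ∧
    ∀ x ∈ Ω, ∀ φ : Rd d → ℝ, TestAt x φ → φ x = u x → (∀ y, y ≠ x → φ y < u y) →
      g x ≤ psiOp S φ x + c x * u x

/-- Viscosity subsolution of `Ψ(−Δ)u + c·u = g` in `Ω`. -/
def IsSubSol {d : ℕ} (S : PsiSetting d) (Ω : Set (Rd d)) (c g u : Rd d → ℝ) : Prop :=
  UpperSemicontinuous u ∧
    ∀ x ∈ Ω, ∀ φ : Rd d → ℝ, TestAt x φ → φ x = u x → (∀ y, y ≠ x → u y < φ y) →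
      psiOp S φ x + c x * u x ≤ g x

/-- Viscosity solution of `Ψ(−Δ)u + c·u = g` in `Ω`. -/
def IsSol {d : ℕ} (S : PsiSetting d) (Ω : Set (Rd d)) (c g u : Rd d → ℝ) : Prop :=
  IsSubSol S Ω c g u ∧ IsSuperSol S Ω c g u

/-- `V` is the renewal function of the ascending ladder-height process associated with `Ψ`. -/
structure IsRenewal (Ψ V : ℝ → ℝ) : Prop where
  nonneg : ∀ x, 0 ≤ V x
  zero : ∀ x ≤ (0:ℝ), V x = 0
  cont : ContinuousOn V (Set.Ioi 0)
  mono : StrictMonoOn V (Set.Ioi 0)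
  laplace : ∀ s : ℝ, 0 < s →
    (∫ x in Set.Ioi (0 : ℝ), V x * Real.exp (-s * x)) =
      1 / (s * Real.exp ((1 / Real.pi) *
        ∫ y in Set.Ioi (0 : ℝ), Real.log (Ψ (s * y)) / (1 + y ^ 2)))

/-- `tr_V(u)(x) = t`: the `V`-trace of `u` at the boundary point `x` of `D`. -/
def HasVTrace {d : ℕ} (V : ℝ → ℝ) (D : Set (Rd d)) (u : Rd d → ℝ)
    (x : Rd d) (t : ℝ) : Prop :=
  Filter.Tendsto (fun z => u z / V (Metric.infDist z Dᶜ)) (nhdsWithin x D) (nhds t)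

/-- An open set has C² boundary. -/
def HasC2Boundary {d : ℕ} (D : Set (Rd d)) : Prop :=
  ∀ x ∈ frontier D, ∃ (U : Set (Rd d)) (f : Rd d → ℝ),
    IsOpen U ∧ x ∈ U ∧ ContDiffOn ℝ 2 f U ∧ (∀ y ∈ U, fderiv ℝ f y ≠ 0) ∧
      D ∩ U = {y ∈ U | f y < 0}

/-- A closed set has C² boundary. -/
def HasC2BoundaryClosed {d : ℕ} (G : Set (Rd d)) : Prop :=
  ∀ x ∈ frontier G, ∃ (U : Set (Rd d)) (f : Rd d → ℝ),
    IsOpen U ∧ x ∈ U ∧ ContDiffOn ℝ 2 f U ∧ (∀ y ∈ U, fderiv ℝ f y ≠ 0) ∧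
      G ∩ U = {y ∈ U | f y ≤ 0}

/-- Reflection `R_{λ,e}` across the hyperplane `{x·e = λ}`. -/
def reflAt {d : ℕ} (e : Rd d) (lam : ℝ) (x : Rd d) : Rd d :=
  x - (2 * ⟪x, e⟫ - 2 * lam) • e

/-- The open half-space `H_{λ,e} = {x·e > λ}`. -/
def halfSpace {d : ℕ} (e : Rd d) (lam : ℝ) : Set (Rd d) := {x | lam < ⟪x, e⟫}

/-- A function is antisymmetric with respect to the half-space `H_{λ,e}`. -/
def AntiSym {d : ℕ} (e : Rd d) (lam : ℝ) (u : Rd d → ℝ) : Prop :=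
  ∀ x, u x = - u (reflAt e lam x)

namespace PsiSetting

variable {d : ℕ} (S : PsiSetting d)

/-- The transition density of Brownian motion with generator `Δ`, as a function of `|x|`. -/
def heat (d : ℕ) (t r : ℝ) : ℝ :=
  (4 * Real.pi * t) ^ (-(d : ℝ) / 2) * Real.exp (-(r ^ 2) / (4 * t))

lemma j_eq (r : ℝ) : S.j r = ∫ t, heat d t r ∂S.m := rfl

lemma ae_pos : ∀ᵐ t ∂S.m, 0 < t := by
  have h := S.m_onIoi
  rw [measure_eq_zero_iff_ae_notMem] at h
  filter_upwards [h] with t ht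
  simpa using ht

lemma psi_pos {r : ℝ} (hr : 1 ≤ r) : 0 < S.Ψ r := by
  refine lt_of_le_of_ne (S.nonneg r (by linarith)) fun h => ?_
  have h1 := S.scaling_lower r r hr le_rfl
  rw [← h, div_zero, div_self (by linarith), Real.one_rpow, mul_one] at h1
  have := S.hb₁
  have : 0 < 1 / S.b₁ := by positivity
  linarith

lemma integrable_one_sub_exp {r : ℝ} (hr : 1 ≤ r) :
    Integrable (fun t => 1 - Real.exp (-r * t)) S.m := by
  by_contra h
  have h1 := S.levy_rep r (by linarith)
  rw [integral_undef h] at h1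
  exact (S.psi_pos hr).ne' h1

instance : SigmaFinite S.m := by
  have h := (S.integrable_one_sub_exp le_rfl).aefinStronglyMeasurable
  have h0 : S.m h.sigmaFiniteSetᶜ = 0 := by
    have h1 := h.ae_eq_zero_compl
    have h2 : ∀ᵐ t ∂S.m, t ∉ h.sigmaFiniteSetᶜ := by
      rw [EventuallyEq, ae_restrict_iff' h.measurableSet.compl] at h1
      filter_upwards [h1, S.ae_pos] with t ht hpos hmem
      have h3 := ht hmem
      have : Real.exp (-1 * t) < 1 := by rw [Real.exp_lt_one_iff]; linarith
      simp only [Pi.zero_apply] at h3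
      linarith
    exact measure_eq_zero_iff_ae_notMem.2 h2
  have h2 : S.m.restrict h.sigmaFiniteSet = S.m :=
    Measure.restrict_eq_self_of_ae_mem (by
      filter_upwards [measure_eq_zero_iff_ae_notMem.1 h0] with t ht
      simpa using ht)
  rw [← h2]
  exact h.sigmaFinite_restrict

lemma measurable_heat : Measurable fun p : ℝ × ℝ => heat d p.2 p.1 := by
  unfold heat
  fun_prop

lemma heat_nonneg {t : ℝ} (ht : 0 < t) (r : ℝ) : 0 ≤ heat d t r := by
  unfold heat; positivity

lemma heat_pos {t : ℝ} (ht : 0 < t) (r : ℝ) : 0 < heat d t r := by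
  unfold heat; positivity

lemma heat_lt {t r r' : ℝ} (ht : 0 < t) (hr : 0 ≤ r) (h : r < r') :
    heat d t r' < heat d t r := by
  unfold heat
  gcongr

lemma measurable_j : Measurable S.j := by
  have h : StronglyMeasurable fun p : ℝ × ℝ => heat d p.2 p.1 :=
    measurable_heat.stronglyMeasurable
  exact h.integral_prod_right.measurable

/-- The jump kernel as an extended nonnegative number. -/
def jL (r : ℝ) : ℝ≥0∞ := ∫⁻ t, ENNReal.ofReal (heat d t r) ∂S.m

lemma measurable_jL : Measurable S.jL := by
  unfold jL
  exact Measurable.lintegral_prod_right' (f := fun p : ℝ × ℝ => ENNReal.ofReal (heat d p.2 p.1))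
    measurable_heat.ennreal_ofReal

lemma jL_anti {r r' : ℝ} (hr : 0 ≤ r) (h : r ≤ r') : S.jL r' ≤ S.jL r := by
  refine lintegral_mono_ae ?_
  filter_upwards [S.ae_pos] with t ht
  rcases h.eq_or_lt with rfl | h
  · exact le_rfl
  · exact ENNReal.ofReal_le_ofReal (heat_lt ht hr h).le

lemma lintegral_heat {t : ℝ} (ht : 0 < t) {F : Rd d → ℝ≥0∞} (hF : Measurable F) :
    ∫⁻ z, F z * ENNReal.ofReal (heat d t ‖z‖) =
      ∫⁻ x, F (√t • x) * ENNReal.ofReal (heat d 1 ‖x‖) := by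
  have hs : 0 < √t := Real.sqrt_pos.2 ht
  have hmap := Measure.map_addHaar_smul (volume : Measure (Rd d)) hs.ne'
  have hG : Measurable fun z : Rd d => F z * ENNReal.ofReal (heat d t ‖z‖) := by
    refine hF.mul (Measurable.ennreal_ofReal ?_)
    exact measurable_heat.comp (measurable_norm.prodMk measurable_const)
  have h1 : ∫⁻ z, F z * ENNReal.ofReal (heat d t ‖z‖) ∂(Measure.map (√t • ·) volume) =
      ∫⁻ x : Rd d, F (√t • x) * ENNReal.ofReal (heat d t ‖√t • x‖) :=
    lintegral_map hG (measurable_const_smul _)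
  rw [hmap, lintegral_smul_measure] at h1
  have hc : |(√t ^ Module.finrank ℝ (Rd d))⁻¹| = t ^ (-(d : ℝ) / 2) := by
    rw [abs_of_nonneg (by positivity), finrank_euclideanSpace_fin, Real.sqrt_eq_rpow,
      ← Real.rpow_natCast, ← Real.rpow_mul ht.le, ← Real.rpow_neg ht.le]
    congr 1; ring
  rw [hc] at h1
  have h2 : ∀ x : Rd d, F (√t • x) * ENNReal.ofReal (heat d t ‖√t • x‖) =
      ENNReal.ofReal (t ^ (-(d : ℝ) / 2)) * (F (√t • x) * ENNReal.ofReal (heat d 1 ‖x‖)) := by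
    intro x
    rw [mul_left_comm, ← ENNReal.ofReal_mul (by positivity)]
    congr 2
    unfold heat
    rw [norm_smul, Real.norm_of_nonneg hs.le, mul_pow, Real.sq_sqrt ht.le,
      Real.mul_rpow (by positivity) ht.le, mul_one, mul_one]
    rw [show -(t * ‖x‖ ^ 2) / (4 * t) = -(‖x‖ ^ 2) / 4 by field_simp]
    ring
  simp_rw [h2] at h1
  rw [lintegral_const_mul] at h1
  · refine (ENNReal.mul_right_inj ?_ ENNReal.ofReal_ne_top).1 h1
    rw [Ne, ENNReal.ofReal_eq_zero, not_le]
    positivity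
  · refine (hF.comp (measurable_const_smul _)).mul (Measurable.ennreal_ofReal ?_)
    exact measurable_heat.comp (measurable_norm.prodMk measurable_const)

lemma lintegral_jL {F : Rd d → ℝ≥0∞} (hF : Measurable F) :
    ∫⁻ z, F z * S.jL ‖z‖ =
      ∫⁻ t, ∫⁻ x, F (√t • x) * ENNReal.ofReal (heat d 1 ‖x‖) ∂volume ∂S.m := by
  have hm : Measurable fun p : Rd d × ℝ => ENNReal.ofReal (heat d p.2 ‖p.1‖) :=
    (measurable_heat.comp ((measurable_norm.comp measurable_fst).prodMk
      measurable_snd)).ennreal_ofReal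
  have h1 : ∀ z : Rd d, F z * S.jL ‖z‖ = ∫⁻ t, F z * ENNReal.ofReal (heat d t ‖z‖) ∂S.m := by
    intro z
    rw [lintegral_const_mul]
    · rfl
    · exact hm.comp (measurable_const.prodMk measurable_id)
  simp_rw [h1]
  rw [lintegral_lintegral_swap ((hF.comp measurable_fst).mul hm).aemeasurable]
  refine lintegral_congr_ae ?_
  filter_upwards [S.ae_pos] with t ht
  exact lintegral_heat ht hF

lemma integrable_exp_neg_norm_sq {b : ℝ} (hb : 0 < b) :
    Integrable fun x : Rd d => Real.exp (-b * ‖x‖ ^ 2) := by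
  have h := (GaussianFourier.integrable_cexp_neg_mul_sq_norm_add (V := Rd d) (b := (b : ℂ))
    (by simpa using hb) 0 0).norm
  refine h.congr (Eventually.of_forall fun x => ?_)
  simp only [zero_mul, add_zero, Complex.norm_exp]
  norm_cast

lemma measurable_heat_norm (t : ℝ) :
    Measurable fun x : Rd d => ENNReal.ofReal (heat d t ‖x‖) :=
  (measurable_heat.comp (measurable_norm.prodMk measurable_const)).ennreal_ofReal

lemma measurable_mul_heat {g : Rd d → ℝ} (hg : Measurable g) :
    Measurable fun x => ENNReal.ofReal (g x) * ENNReal.ofReal (heat d 1 ‖x‖) :=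
  hg.ennreal_ofReal.mul (measurable_heat_norm 1)

lemma lintegral_max_heat_lt_top :
    ∫⁻ x : Rd d, ENNReal.ofReal (max 1 (‖x‖ ^ 2)) * ENNReal.ofReal (heat d 1 ‖x‖) < ∞ := by
  have hi := ((integrable_exp_neg_norm_sq (d := d) (b := 1 / 8) (by norm_num)).const_mul
    (8 * (4 * Real.pi * 1) ^ (-(d : ℝ) / 2))).lintegral_lt_top
  refine lt_of_le_of_lt (lintegral_mono fun x => ?_) hi
  rw [← ENNReal.ofReal_mul (by positivity)]
  refine ENNReal.ofReal_le_ofReal ?_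
  unfold heat
  have h1 : max 1 (‖x‖ ^ 2) ≤ 8 * Real.exp (‖x‖ ^ 2 / 8) := by
    have h2 := Real.add_one_le_exp (‖x‖ ^ 2 / 8)
    have := sq_nonneg ‖x‖
    exact max_le (by linarith) (by linarith)
  have h3 : Real.exp (-(‖x‖ ^ 2) / (4 * 1)) * Real.exp (‖x‖ ^ 2 / 8) =
      Real.exp (-(1 / 8) * ‖x‖ ^ 2) := by
    rw [← Real.exp_add]; congr 1; ring
  calc max 1 (‖x‖ ^ 2) * ((4 * Real.pi * 1) ^ (-(d : ℝ) / 2) * Real.exp (-(‖x‖ ^ 2) / (4 * 1)))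
      ≤ (8 * Real.exp (‖x‖ ^ 2 / 8)) *
        ((4 * Real.pi * 1) ^ (-(d : ℝ) / 2) * Real.exp (-(‖x‖ ^ 2) / (4 * 1))) := by gcongr
    _ = _ := by rw [← h3]; ring

lemma lintegral_min_heat_pos (hd : 2 ≤ d) :
    0 < ∫⁻ x : Rd d, ENNReal.ofReal (min 1 (‖x‖ ^ 2)) * ENNReal.ofReal (heat d 1 ‖x‖) := by
  have : Nonempty (Fin d) := ⟨⟨0, by omega⟩⟩
  rw [lintegral_pos_iff_support (measurable_mul_heat (by fun_prop))]
  refine lt_of_lt_of_le (IsOpen.measure_pos volume (isOpen_compl_singleton (x := (0 : Rd d)))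
    ?_) (measure_mono ?_)
  · exact exists_ne 0
  · intro x hx
    have hx' : 0 < ‖x‖ := norm_pos_iff.2 hx
    rw [Function.mem_support]
    refine mul_ne_zero ?_ ?_ <;> rw [Ne, ENNReal.ofReal_eq_zero, not_le]
    · positivity
    · exact heat_pos one_pos _

lemma min_one_le {s : ℝ} (hs : 0 ≤ s) : min 1 s ≤ 2 * (1 - Real.exp (-s)) := by
  have h1 := Real.add_one_le_exp s
  have h2 : Real.exp (-s) ≤ 1 / (1 + s) := by
    rw [Real.exp_neg, inv_eq_one_div]
    exact one_div_le_one_div_of_le (by linarith) (by linarith)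
  have h3 : 1 / (1 + s) ≤ 1 - min 1 s / 2 := by
    rw [div_le_iff₀ (by linarith)]
    rcases le_total 1 s with h | h
    · rw [min_eq_left h]; linarith
    · rw [min_eq_right h]; nlinarith
  linarith

lemma one_sub_exp_le_min (s : ℝ) : 1 - Real.exp (-s) ≤ min 1 s := by
  have h1 := Real.add_one_le_exp (-s)
  have h2 := Real.exp_pos (-s)
  exact le_min (by linarith) (by linarith)

lemma ofReal_psi {δ : ℝ} (hδ : 0 < δ) (hδ1 : δ ≤ 1) :
    ENNReal.ofReal (S.Ψ ((δ ^ 2)⁻¹)) =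
      ∫⁻ t, ENNReal.ofReal (1 - Real.exp (-(t / δ ^ 2))) ∂S.m := by
  have h1 : 1 ≤ (δ ^ 2)⁻¹ := (one_le_inv₀ (by positivity)).2 (by nlinarith)
  have h2 := S.integrable_one_sub_exp h1
  rw [S.levy_rep _ (by linarith), ofReal_integral_eq_lintegral_ofReal h2]
  · refine lintegral_congr fun t => ?_
    congr 4; ring
  · filter_upwards [S.ae_pos] with t ht
    have : Real.exp (-(δ ^ 2)⁻¹ * t) ≤ 1 := by
      rw [Real.exp_le_one_iff]
      have : 0 ≤ (δ ^ 2)⁻¹ * t := by positivity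
      linarith
    simp only [Pi.zero_apply]
    linarith

lemma lintegral_min_jL (δ : ℝ) :
    ∫⁻ z : Rd d, ENNReal.ofReal (min 1 (‖z‖ ^ 2 / δ ^ 2)) * S.jL ‖z‖ =
      ∫⁻ t, ∫⁻ x : Rd d, ENNReal.ofReal (min 1 (t / δ ^ 2 * ‖x‖ ^ 2)) *
        ENNReal.ofReal (heat d 1 ‖x‖) ∂volume ∂S.m := by
  rw [S.lintegral_jL (F := fun z : Rd d => ENNReal.ofReal (min 1 (‖z‖ ^ 2 / δ ^ 2)))
    (by fun_prop)]
  refine lintegral_congr_ae ?_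
  filter_upwards [S.ae_pos] with t ht
  refine lintegral_congr fun x => ?_
  rw [norm_smul, mul_pow, Real.norm_of_nonneg (Real.sqrt_nonneg t), Real.sq_sqrt ht.le]
  congr 3; ring

lemma lintegral_min_jL_le {δ : ℝ} (hδ : 0 < δ) (hδ1 : δ ≤ 1) :
    ∫⁻ z : Rd d, ENNReal.ofReal (min 1 (‖z‖ ^ 2 / δ ^ 2)) * S.jL ‖z‖ ≤
      2 * (∫⁻ x : Rd d, ENNReal.ofReal (max 1 (‖x‖ ^ 2)) * ENNReal.ofReal (heat d 1 ‖x‖)) *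
        ENNReal.ofReal (S.Ψ ((δ ^ 2)⁻¹)) := by
  rw [S.lintegral_min_jL, S.ofReal_psi hδ hδ1, ← lintegral_const_mul _ (by fun_prop)]
  refine lintegral_mono_ae ?_
  filter_upwards [S.ae_pos] with t ht
  have hs : 0 ≤ t / δ ^ 2 := by positivity
  rw [mul_comm 2, mul_assoc, ← lintegral_mul_const _ (measurable_mul_heat (by fun_prop))]
  refine lintegral_mono fun x => ?_
  have h2 (y : ℝ) : 2 * ENNReal.ofReal y = ENNReal.ofReal (2 * y) := by
    rw [ENNReal.ofReal_mul (by norm_num)]; norm_num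
  rw [mul_right_comm, h2,
    ← ENNReal.ofReal_mul (p := max 1 (‖x‖ ^ 2)) (by positivity)]
  refine mul_le_mul' (ENNReal.ofReal_le_ofReal ?_) le_rfl
  refine le_trans ?_ (mul_le_mul_of_nonneg_left (min_one_le hs) (by positivity))
  have hm : 1 ≤ max 1 (‖x‖ ^ 2) := le_max_left _ _
  rcases le_total 1 (t / δ ^ 2) with h | h
  · rw [min_eq_left h, mul_one]; exact (min_le_left _ _).trans hm
  · rw [min_eq_right h]
    refine (min_le_right _ _).trans ?_
    rw [mul_comm]
    gcongr
    exact le_max_right _ _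

lemma le_lintegral_min_jL {δ : ℝ} (hδ : 0 < δ) (hδ1 : δ ≤ 1) :
    (∫⁻ x : Rd d, ENNReal.ofReal (min 1 (‖x‖ ^ 2)) * ENNReal.ofReal (heat d 1 ‖x‖)) *
        ENNReal.ofReal (S.Ψ ((δ ^ 2)⁻¹)) ≤
      ∫⁻ z : Rd d, ENNReal.ofReal (min 1 (‖z‖ ^ 2 / δ ^ 2)) * S.jL ‖z‖ := by
  rw [S.lintegral_min_jL, S.ofReal_psi hδ hδ1, ← lintegral_const_mul _ (by fun_prop)]
  refine lintegral_mono_ae ?_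
  filter_upwards [S.ae_pos] with t ht
  have hs : 0 ≤ t / δ ^ 2 := by positivity
  rw [← lintegral_mul_const _ (measurable_mul_heat (by fun_prop))]
  refine lintegral_mono fun x => ?_
  rw [mul_right_comm, ← ENNReal.ofReal_mul (by positivity)]
  refine mul_le_mul' (ENNReal.ofReal_le_ofReal ?_) le_rfl
  refine (mul_le_mul_of_nonneg_left (one_sub_exp_le_min _) (by positivity)).trans ?_
  rw [mul_comm]
  have hx : 0 ≤ ‖x‖ ^ 2 := by positivity
  refine le_min ?_ ?_
  · exact mul_le_one₀ (min_le_left _ _) (by positivity) (min_le_left _ _)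
  · exact mul_le_mul (min_le_right _ _) (min_le_right _ _) (by positivity) hs

lemma jL_lt_top (hd : 2 ≤ d) {r : ℝ} (hr : 0 < r) : S.jL r < ∞ := by
  have : Nonempty (Fin d) := ⟨⟨0, by omega⟩⟩
  by_contra h
  rw [not_lt, top_le_iff] at h
  have h1 := S.lintegral_min_jL_le one_pos le_rfl
  have h2 : ∫⁻ z : Rd d, ENNReal.ofReal (min 1 (‖z‖ ^ 2 / 1 ^ 2)) * S.jL ‖z‖ < ∞ :=
    lt_of_le_of_lt h1 (ENNReal.mul_lt_top (ENNReal.mul_lt_top (by norm_num)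
      lintegral_max_heat_lt_top) ENNReal.ofReal_lt_top)
  have hm : Measurable fun z : Rd d => ENNReal.ofReal (min 1 (‖z‖ ^ 2 / 1 ^ 2)) * S.jL ‖z‖ :=
    Measurable.mul (by fun_prop) (S.measurable_jL.comp measurable_norm)
  have h3 := ae_lt_top hm h2.ne
  have hopen : IsOpen (ball (0 : Rd d) r ∩ {0}ᶜ) := isOpen_ball.inter isOpen_compl_singleton
  have hpos : 0 < volume (ball (0 : Rd d) r ∩ {0}ᶜ) := by
    refine hopen.measure_pos _ ?_
    obtain ⟨y, hy⟩ := exists_norm_eq (Rd d) (half_pos hr).le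
    refine ⟨y, ?_, ?_⟩
    · simp [hy, hr]
    · have : 0 < ‖y‖ := by rw [hy]; linarith
      exact norm_pos_iff.1 this
  refine hpos.ne' (measure_mono_null ?_ (ae_iff.1 h3))
  rintro z ⟨hz, hz0⟩
  have hz1 : ‖z‖ ≤ r := by simpa using (mem_ball_zero_iff.1 hz).le
  have hz2 : S.jL ‖z‖ = ∞ := top_le_iff.1 (h ▸ S.jL_anti (norm_nonneg z) hz1)
  have hz3 : 0 < ‖z‖ := norm_pos_iff.2 hz0
  rw [Set.mem_ofPred_eq, hz2, ENNReal.mul_top]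
  · simp
  · rw [Ne, ENNReal.ofReal_eq_zero, not_le]; positivity

lemma integrable_heat (hd : 2 ≤ d) {r : ℝ} (hr : 0 < r) :
    Integrable (fun t => heat d t r) S.m := by
  refine ⟨(measurable_heat.comp (measurable_const.prodMk measurable_id)).aestronglyMeasurable, ?_⟩
  rw [hasFiniteIntegral_iff_ofReal]
  · exact S.jL_lt_top hd hr
  · filter_upwards [S.ae_pos] with t ht
    exact heat_nonneg ht r

lemma ofReal_j (hd : 2 ≤ d) {r : ℝ} (hr : 0 < r) : ENNReal.ofReal (S.j r) = S.jL r := by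
  rw [j_eq, ofReal_integral_eq_lintegral_ofReal (S.integrable_heat hd hr)]
  · rfl
  · filter_upwards [S.ae_pos] with t ht
    exact heat_nonneg ht r

lemma m_ne_zero : S.m ≠ 0 := by
  intro h
  have := S.levy_rep 1 one_pos
  rw [h, integral_zero_measure] at this
  exact (S.psi_pos le_rfl).ne' this

lemma integral_pos_of_ae_pos {g : ℝ → ℝ} (hg : Integrable g S.m) (h : ∀ t, 0 < t → 0 < g t) :
    0 < ∫ t, g t ∂S.m := by
  rw [integral_pos_iff_support_of_nonneg_ae _ hg]
  · rw [pos_iff_ne_zero]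
    intro h0
    apply S.m_ne_zero
    rw [← Measure.measure_univ_eq_zero]
    refine measure_mono_null (t := Function.support g ∪ Iic 0) (fun t _ => ?_)
      (measure_union_null h0 S.m_onIoi)
    rcases le_or_gt t 0 with ht | ht
    · exact Or.inr ht
    · exact Or.inl (h t ht).ne'
  · filter_upwards [S.ae_pos] with t ht
    exact (h t ht).le

lemma j_pos (hd : 2 ≤ d) {r : ℝ} (hr : 0 < r) : 0 < S.j r :=
  S.integral_pos_of_ae_pos (S.integrable_heat hd hr) fun _ ht => heat_pos ht r

lemma j_lt (hd : 2 ≤ d) {r r' : ℝ} (hr : 0 < r) (h : r < r') : S.j r' < S.j r := by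
  have h1 := S.integral_pos_of_ae_pos
    ((S.integrable_heat hd hr).sub (S.integrable_heat hd (hr.trans h)))
    fun t ht => sub_pos.2 (heat_lt ht hr.le h)
  simp only [Pi.sub_apply] at h1
  rw [integral_sub (S.integrable_heat hd hr) (S.integrable_heat hd (hr.trans h))] at h1
  exact sub_pos.1 h1

lemma j_anti (hd : 2 ≤ d) {r r' : ℝ} (hr : 0 < r) (h : r ≤ r') : S.j r' ≤ S.j r := by
  rcases h.eq_or_lt with rfl | h
  · exact le_rfl
  · exact (S.j_lt hd hr h).le

lemma j_nonneg (r : ℝ) : 0 ≤ S.j r := by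
  refine integral_nonneg_of_ae ?_
  filter_upwards [S.ae_pos] with t ht
  exact heat_nonneg ht r

/-- The Lévy measure `j(|z|) dz`. -/
def levy : Measure (Rd d) := volume.withDensity fun z => ENNReal.ofReal (S.j ‖z‖)

lemma measurable_j_norm : Measurable fun z : Rd d => ENNReal.ofReal (S.j ‖z‖) :=
  (S.measurable_j.comp measurable_norm).ennreal_ofReal

lemma lintegral_levy {F : Rd d → ℝ≥0∞} (hF : Measurable F) :
    ∫⁻ z, F z ∂S.levy = ∫⁻ z, F z * ENNReal.ofReal (S.j ‖z‖) := by
  rw [levy, lintegral_withDensity_eq_lintegral_mul _ S.measurable_j_norm hF]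
  simp only [Pi.mul_apply, mul_comm]

lemma lintegral_levy_jL (hd : 2 ≤ d) {F : Rd d → ℝ≥0∞} (hF : Measurable F) :
    ∫⁻ z, F z ∂S.levy = ∫⁻ z, F z * S.jL ‖z‖ := by
  have : Nonempty (Fin d) := ⟨⟨0, by omega⟩⟩
  rw [S.lintegral_levy hF]
  refine lintegral_congr_ae ?_
  have h0 : ∀ᵐ z : Rd d, z ≠ 0 := by
    rw [ae_iff]; simp
  filter_upwards [h0] with z hz
  rw [S.ofReal_j hd (norm_pos_iff.2 hz)]

lemma integral_levy (g : Rd d → ℝ) : ∫ z, g z ∂S.levy = ∫ z, g z * S.j ‖z‖ := by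
  rw [levy, integral_withDensity_eq_integral_toReal_smul S.measurable_j_norm
    (Eventually.of_forall fun _ => ENNReal.ofReal_lt_top)]
  refine integral_congr_ae (Eventually.of_forall fun z => ?_)
  simp only [ENNReal.toReal_ofReal (S.j_nonneg _), smul_eq_mul, mul_comm]

lemma levy_map (L : Rd d ≃ₗᵢ[ℝ] Rd d) : S.levy.map L = S.levy := by
  ext s hs
  have hL := L.measurePreserving
  rw [Measure.map_apply L.continuous.measurable hs, levy, withDensity_apply _ hs,
    withDensity_apply _ (L.continuous.measurable hs),
    ← hL.setLIntegral_comp_preimage hs S.measurable_j_norm]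
  simp

lemma measurePreserving_levy (L : Rd d ≃ₗᵢ[ℝ] Rd d) : MeasurePreserving L S.levy S.levy :=
  ⟨L.continuous.measurable, S.levy_map L⟩

lemma integral_levy_comp (L : Rd d ≃ₗᵢ[ℝ] Rd d) (g : Rd d → ℝ) :
    ∫ z, g (L z) ∂S.levy = ∫ z, g z ∂S.levy :=
  (S.measurePreserving_levy L).integral_comp L.toHomeomorph.measurableEmbedding g

lemma integral_levy_of_odd {g : Rd d → ℝ} (hg : ∀ z, g (-z) = - g z) :
    ∫ z, g z ∂S.levy = 0 := by
  have h := S.integral_levy_comp (LinearIsometryEquiv.neg ℝ) g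
  simp only [LinearIsometryEquiv.coe_neg, hg, integral_neg] at h
  linarith

/-- The truncated second moment of the Lévy measure at scale `δ`. -/
def trunc (δ : ℝ) : ℝ := ∫ z, min 1 (‖z‖ ^ 2 / δ ^ 2) ∂S.levy

lemma lintegral_trunc_lt_top (hd : 2 ≤ d) {δ : ℝ} (hδ : 0 < δ) (hδ1 : δ ≤ 1) :
    ∫⁻ z : Rd d, ENNReal.ofReal (min 1 (‖z‖ ^ 2 / δ ^ 2)) ∂S.levy < ∞ := by
  rw [S.lintegral_levy_jL hd (by fun_prop)]
  exact lt_of_le_of_lt (S.lintegral_min_jL_le hδ hδ1) (ENNReal.mul_lt_top (ENNReal.mul_lt_top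
    (by norm_num) lintegral_max_heat_lt_top) ENNReal.ofReal_lt_top)

lemma integrable_min_one (hd : 2 ≤ d) : Integrable (fun z : Rd d => min 1 (‖z‖ ^ 2)) S.levy := by
  refine ⟨by fun_prop, ?_⟩
  rw [hasFiniteIntegral_iff_ofReal (Eventually.of_forall fun z => by simp)]
  simpa using S.lintegral_trunc_lt_top hd one_pos le_rfl

lemma integrable_levy (hd : 2 ≤ d) {g : Rd d → ℝ} (hg : Measurable g) {C : ℝ}
    (h : ∀ z, |g z| ≤ C * min 1 (‖z‖ ^ 2)) : Integrable g S.levy :=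
  ((S.integrable_min_one hd).const_mul C).mono' hg.aestronglyMeasurable
    (Eventually.of_forall fun z => h z)

lemma integrable_trunc (hd : 2 ≤ d) {δ : ℝ} (hδ : 0 < δ) :
    Integrable (fun z : Rd d => min 1 (‖z‖ ^ 2 / δ ^ 2)) S.levy := by
  refine S.integrable_levy hd (by fun_prop) (C := max 1 (1 / δ ^ 2)) fun z => ?_
  have hz : 0 ≤ ‖z‖ ^ 2 := by positivity
  rw [abs_of_nonneg (by positivity)]
  have h1 : (1 : ℝ) ≤ max 1 (1 / δ ^ 2) := le_max_left _ _
  have h2 : 1 / δ ^ 2 ≤ max 1 (1 / δ ^ 2) := le_max_right _ _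
  rcases le_total 1 (‖z‖ ^ 2) with h | h
  · rw [min_eq_left h, mul_one]
    exact (min_le_left _ _).trans h1
  · rw [min_eq_right h]
    refine (min_le_right _ _).trans ?_
    rw [div_eq_mul_one_div, mul_comm]
    gcongr

lemma trunc_nonneg (δ : ℝ) : 0 ≤ S.trunc δ :=
  integral_nonneg fun z => by
    show 0 ≤ min 1 (‖z‖ ^ 2 / δ ^ 2)
    positivity

lemma trunc_le (hd : 2 ≤ d) {s A : ℝ} (hs : 0 < s) (hA : 1 ≤ A) :
    S.trunc s ≤ A ^ 2 * S.trunc (s * A) := by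
  rw [trunc, trunc, ← integral_const_mul]
  refine integral_mono (S.integrable_trunc hd hs)
    ((S.integrable_trunc hd (by positivity)).const_mul _) fun z => ?_
  have hz : 0 ≤ ‖z‖ ^ 2 := by positivity
  have h1 : 1 ≤ A ^ 2 := by nlinarith
  show min 1 (‖z‖ ^ 2 / s ^ 2) ≤ A ^ 2 * min 1 (‖z‖ ^ 2 / (s * A) ^ 2)
  rcases le_total 1 (‖z‖ ^ 2 / (s * A) ^ 2) with h | h
  · rw [min_eq_left h, mul_one]
    exact (min_le_left _ _).trans h1
  · rw [min_eq_right h]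
    refine (min_le_right _ _).trans (le_of_eq ?_)
    field_simp

lemma exists_trunc_bounds (hd : 2 ≤ d) : ∃ c C : ℝ, 0 < c ∧ 0 < C ∧ ∀ δ, 0 < δ → δ ≤ 1 →
    c * S.Ψ ((δ ^ 2)⁻¹) ≤ S.trunc δ ∧ S.trunc δ ≤ C * S.Ψ ((δ ^ 2)⁻¹) := by
  set a := ∫⁻ x : Rd d, ENNReal.ofReal (min 1 (‖x‖ ^ 2)) * ENNReal.ofReal (heat d 1 ‖x‖)
  set b := ∫⁻ x : Rd d, ENNReal.ofReal (max 1 (‖x‖ ^ 2)) * ENNReal.ofReal (heat d 1 ‖x‖)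
  have ha : 0 < a := lintegral_min_heat_pos hd
  have hb : b < ∞ := lintegral_max_heat_lt_top
  have hab : a ≤ b := lintegral_mono fun x => mul_le_mul'
    (ENNReal.ofReal_le_ofReal ((min_le_left _ _).trans (le_max_left _ _))) le_rfl
  have ha' : 0 < a.toReal := ENNReal.toReal_pos ha.ne' (hab.trans_lt hb).ne
  have hb' : 0 < b.toReal := ENNReal.toReal_pos (ha.trans_le hab).ne' hb.ne
  refine ⟨a.toReal, 2 * b.toReal, ha', by positivity, fun δ hδ hδ1 => ?_⟩
  have hΨ : 0 ≤ S.Ψ ((δ ^ 2)⁻¹) := S.nonneg _ (by positivity)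
  have ht : S.trunc δ = (∫⁻ z : Rd d, ENNReal.ofReal (min 1 (‖z‖ ^ 2 / δ ^ 2)) *
      S.jL ‖z‖).toReal := by
    rw [← S.lintegral_levy_jL hd (by fun_prop), trunc,
      integral_eq_lintegral_of_nonneg_ae _ (by fun_prop)]
    exact Eventually.of_forall fun z => by
      show 0 ≤ min 1 (‖z‖ ^ 2 / δ ^ 2)
      positivity
  have hlt := S.lintegral_trunc_lt_top hd hδ hδ1
  rw [S.lintegral_levy_jL hd (by fun_prop)] at hlt
  rw [ht]
  constructor
  · have := ENNReal.toReal_mono hlt.ne (S.le_lintegral_min_jL hδ hδ1)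
    rwa [ENNReal.toReal_mul, ENNReal.toReal_ofReal hΨ] at this
  · have := ENNReal.toReal_mono (ENNReal.mul_lt_top (ENNReal.mul_lt_top (by norm_num) hb)
      ENNReal.ofReal_lt_top).ne (S.lintegral_min_jL_le hδ hδ1)
    rwa [ENNReal.toReal_mul, ENNReal.toReal_mul, ENNReal.toReal_ofReal hΨ] at this

lemma tendsto_trunc (hd : 2 ≤ d) : Tendsto S.trunc (𝓝[>] 0) atTop := by
  obtain ⟨c, C, hc, -, h⟩ := S.exists_trunc_bounds hd
  have hb₁ := S.hb₁
  have hΨ := S.psi_pos le_rfl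
  have h1 : Tendsto (fun δ : ℝ => (δ ^ 2)⁻¹) (𝓝[>] 0) atTop := by
    have : Tendsto (fun δ : ℝ => (δ⁻¹) ^ 2) (𝓝[>] 0) atTop :=
      (tendsto_pow_atTop two_ne_zero).comp tendsto_inv_nhdsGT_zero
    simpa using this
  have h2 := ((tendsto_rpow_atTop S.ha₁).comp h1).const_mul_atTop
    (show 0 < c * (S.Ψ 1 / S.b₁) by positivity)
  refine tendsto_atTop_mono' _ ?_ h2
  filter_upwards [Ioc_mem_nhdsGT one_pos] with δ hδ
  have hδ1 : 1 ≤ (δ ^ 2)⁻¹ :=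
    (one_le_inv₀ (pow_pos hδ.1 2)).2 (pow_le_one₀ hδ.1.le hδ.2)
  refine le_trans ?_ (h δ hδ.1 hδ.2).1
  have h3 := S.scaling_lower 1 _ le_rfl hδ1
  rw [le_div_iff₀ hΨ, div_one] at h3
  simp only [Function.comp]
  rw [mul_assoc]
  refine mul_le_mul_of_nonneg_left (le_trans (le_of_eq ?_) h3) hc.le
  ring

lemma levy_norm_gt_lt_top (hd : 2 ≤ d) {δ : ℝ} (hδ : 0 < δ) :
    S.levy {z | δ < ‖z‖} < ∞ := by
  refine lt_of_le_of_lt (measure_mono ?_) ((S.integrable_trunc hd hδ).measure_norm_ge_lt_top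
    (ε := 1) one_pos)
  intro z hz
  have hz : δ < ‖z‖ := hz
  show 1 ≤ ‖min 1 (‖z‖ ^ 2 / δ ^ 2)‖
  rw [min_eq_left]
  · simp
  · rw [one_le_div (by positivity)]; gcongr

lemma levy_eq (s : Set (Rd d)) (hs : MeasurableSet s) :
    S.levy s = ∫⁻ z in s, ENNReal.ofReal (S.j ‖z‖) := withDensity_apply _ hs

lemma volume_ball (x : Rd d) {r : ℝ} (hr : 0 ≤ r) :
    volume (closedBall x r) = ENNReal.ofReal (r ^ d) * volume (ball (0 : Rd d) 1) := by
  rw [Measure.addHaar_closedBall _ _ hr]; simp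

lemma levy_annulus_le (hd : 2 ≤ d) {r R : ℝ} (hr : 0 < r) (hR : r < R) :
    S.levy {z | r < ‖z‖ ∧ ‖z‖ ≤ R} ≤
      ENNReal.ofReal (S.j r) * (ENNReal.ofReal (R ^ d) * volume (ball (0 : Rd d) 1)) := by
  have hm : MeasurableSet {z : Rd d | r < ‖z‖ ∧ ‖z‖ ≤ R} := by measurability
  rw [S.levy_eq _ hm, ← volume_ball 0 (by linarith), ← setLIntegral_const]
  refine (setLIntegral_mono measurable_const fun z hz => ENNReal.ofReal_le_ofReal
    (S.j_anti hd hr hz.1.le)).trans (lintegral_mono_set fun z hz => ?_)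
  simpa using hz.2

lemma le_levy (hd : 2 ≤ d) {R : ℝ} {s : Set (Rd d)} (hs : MeasurableSet s)
    (h : ∀ z ∈ s, z ≠ 0 ∧ ‖z‖ ≤ R) : ENNReal.ofReal (S.j R) * volume s ≤ S.levy s := by
  rw [S.levy_eq _ hs, ← setLIntegral_const]
  exact setLIntegral_mono S.measurable_j_norm fun z hz => ENNReal.ofReal_le_ofReal
    (S.j_anti hd (norm_pos_iff.2 (h z hz).1) (h z hz).2)

lemma exists_trunc_annulus (hd : 2 ≤ d) : ∃ A : ℝ, 1 < A ∧ ∀ r, 0 < r → r * A ≤ 1 →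
    S.trunc r ≤ 2 * (S.levy {z | r / A < ‖z‖ ∧ ‖z‖ ≤ r * A}).toReal := by
  obtain ⟨c, C, hc, hC, h⟩ := S.exists_trunc_bounds hd
  have hb₁ : 0 < S.b₁ := by linarith [S.hb₁]
  set q := C * S.b₁ / c with hq
  have hq0 : 0 < q := by positivity
  have hlim : Tendsto (fun B : ℝ => q * (B ^ (-(1 - S.a₂)) + B ^ (-S.a₁))) atTop
      (𝓝 (q * (0 + 0))) :=
    ((tendsto_rpow_neg_atTop (by linarith [S.ha₂])).add
      (tendsto_rpow_neg_atTop S.ha₁)).const_mul q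
  rw [add_zero, mul_zero] at hlim
  obtain ⟨B, hB, hB1⟩ := ((hlim.eventually_le_const (show (0 : ℝ) < 1 / 2 by norm_num)).and
    (eventually_gt_atTop 1)).exists
  have hB0 : 0 < B := by linarith
  obtain ⟨A, hA, rfl⟩ : ∃ A : ℝ, 1 < A ∧ A ^ 2 = B :=
    ⟨√B, Real.lt_sqrt_of_sq_lt (by simpa using hB1), Real.sq_sqrt hB0.le⟩
  refine ⟨A, hA, fun r hr hrA => ?_⟩
  have hA0 : 0 < A := by linarith
  have hr1 : r ≤ 1 := le_trans (by nlinarith) hrA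
  have hΨr := S.psi_pos (show 1 ≤ (r ^ 2)⁻¹ from
    (one_le_inv₀ (by positivity)).2 (pow_le_one₀ hr.le hr1))
  have hk := (h r hr hr1).1
  have hk0 : 0 < S.trunc r := lt_of_lt_of_le (by positivity) hk
  have h1 : S.trunc (r / A) ≤ q * (A ^ 2) ^ S.a₂ * S.trunc r := by
    have hrA1 : r / A ≤ 1 := (div_le_one hA0).2 (by linarith)
    have h2 := S.scaling_upper (r ^ 2)⁻¹ ((r / A) ^ 2)⁻¹
      ((one_le_inv₀ (by positivity)).2 (pow_le_one₀ hr.le hr1))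
      (by gcongr; exact (div_le_self hr.le hA.le))
    rw [div_le_iff₀ hΨr, show ((r / A) ^ 2)⁻¹ / (r ^ 2)⁻¹ = A ^ 2 by field_simp] at h2
    calc S.trunc (r / A) ≤ C * S.Ψ ((r / A) ^ 2)⁻¹ := (h _ (by positivity) hrA1).2
      _ ≤ C * (S.b₁ * (A ^ 2) ^ S.a₂ * (S.trunc r / c)) := by
        gcongr
        refine h2.trans ?_
        gcongr
        rwa [le_div_iff₀ hc, mul_comm]
      _ = _ := by rw [hq]; ring
  have h2 : S.trunc (r * A) ≤ q * (A ^ 2) ^ (-S.a₁) * S.trunc r := by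
    have hrA1 : 1 ≤ ((r * A) ^ 2)⁻¹ :=
      (one_le_inv₀ (by positivity)).2 (pow_le_one₀ (by positivity) hrA)
    have hΨ := S.psi_pos hrA1
    have h2 := S.scaling_lower ((r * A) ^ 2)⁻¹ (r ^ 2)⁻¹ hrA1
      (by gcongr; nlinarith)
    rw [le_div_iff₀ hΨ, show (r ^ 2)⁻¹ / ((r * A) ^ 2)⁻¹ = A ^ 2 by field_simp] at h2
    have h3 : 0 < (A ^ 2) ^ S.a₁ := by positivity
    calc S.trunc (r * A) ≤ C * S.Ψ ((r * A) ^ 2)⁻¹ := (h _ (by positivity) hrA).2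
      _ ≤ C * (S.b₁ * (A ^ 2) ^ (-S.a₁) * (S.trunc r / c)) := by
        gcongr
        rw [Real.rpow_neg (by positivity)]
        calc S.Ψ ((r * A) ^ 2)⁻¹ = S.b₁ * ((A ^ 2) ^ S.a₁)⁻¹ *
              (1 / S.b₁ * (A ^ 2) ^ S.a₁ * S.Ψ ((r * A) ^ 2)⁻¹) := by field_simp
          _ ≤ S.b₁ * ((A ^ 2) ^ S.a₁)⁻¹ * (S.trunc r / c) := by
            gcongr
            refine h2.trans ?_
            rwa [le_div_iff₀ hc, mul_comm]
      _ = _ := by rw [hq]; ring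
  have hann : MeasurableSet {z : Rd d | r / A < ‖z‖ ∧ ‖z‖ ≤ r * A} := by measurability
  have hfin : S.levy {z | r / A < ‖z‖ ∧ ‖z‖ ≤ r * A} < ∞ :=
    (measure_mono fun z hz => hz.1).trans_lt (S.levy_norm_gt_lt_top hd (show 0 < r / A by positivity))
  have hint : Integrable ({z : Rd d | r / A < ‖z‖ ∧ ‖z‖ ≤ r * A}.indicator fun _ => (1 : ℝ))
      S.levy := (integrable_indicator_iff hann).2 (integrableOn_const hfin.ne)
  have hsplit : S.trunc r ≤ (A ^ 2)⁻¹ * S.trunc (r / A) + S.trunc (r * A) +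
      (S.levy {z | r / A < ‖z‖ ∧ ‖z‖ ≤ r * A}).toReal := by
    have e : (S.levy {z | r / A < ‖z‖ ∧ ‖z‖ ≤ r * A}).toReal =
        ∫ z, {z : Rd d | r / A < ‖z‖ ∧ ‖z‖ ≤ r * A}.indicator (fun _ => (1 : ℝ)) z ∂S.levy := by
      rw [integral_indicator hann]; simp [Measure.real]
    have i1 := (S.integrable_trunc hd (show 0 < r / A by positivity)).const_mul (A ^ 2)⁻¹
    have i2 := S.integrable_trunc hd (show 0 < r * A by positivity)
    have i3 : Integrable (fun z : Rd d => (A ^ 2)⁻¹ * min 1 (‖z‖ ^ 2 / (r / A) ^ 2) +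
      min 1 (‖z‖ ^ 2 / (r * A) ^ 2)) S.levy := i1.add i2
    rw [e, trunc, trunc, trunc, ← integral_const_mul, ← integral_add i1 i2,
      ← integral_add i3 hint]
    refine integral_mono (S.integrable_trunc hd hr) (i3.add hint) fun z => ?_
    show min 1 (‖z‖ ^ 2 / r ^ 2) ≤ (A ^ 2)⁻¹ * min 1 (‖z‖ ^ 2 / (r / A) ^ 2) +
      min 1 (‖z‖ ^ 2 / (r * A) ^ 2) + _
    have p1 : 0 ≤ (A ^ 2)⁻¹ * min 1 (‖z‖ ^ 2 / (r / A) ^ 2) := by positivity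
    have p2 : 0 ≤ min 1 (‖z‖ ^ 2 / (r * A) ^ 2) := by positivity
    have p3 : 0 ≤ {z : Rd d | r / A < ‖z‖ ∧ ‖z‖ ≤ r * A}.indicator (fun _ => (1 : ℝ)) z :=
      indicator_nonneg (fun _ _ => zero_le_one) _
    have p4 := min_le_left 1 (‖z‖ ^ 2 / r ^ 2)
    rcases le_or_gt ‖z‖ (r / A) with hz | hz
    · have : ‖z‖ ^ 2 / (r / A) ^ 2 ≤ 1 := by rw [div_le_one (by positivity)]; gcongr
      rw [min_eq_right this] at p1 ⊢
      have e : (A ^ 2)⁻¹ * (‖z‖ ^ 2 / (r / A) ^ 2) = ‖z‖ ^ 2 / r ^ 2 := by field_simp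
      have := min_le_right 1 (‖z‖ ^ 2 / r ^ 2)
      linarith
    rcases le_or_gt ‖z‖ (r * A) with hz' | hz'
    · rw [indicator_of_mem (show z ∈ {z : Rd d | r / A < ‖z‖ ∧ ‖z‖ ≤ r * A} from ⟨hz, hz'⟩)]
      linarith
    · have : 1 ≤ ‖z‖ ^ 2 / (r * A) ^ 2 := by rw [one_le_div (by positivity)]; gcongr
      rw [min_eq_left this] at p2 ⊢
      linarith
  have h3 : (A ^ 2)⁻¹ * (A ^ 2) ^ S.a₂ = (A ^ 2) ^ (-(1 - S.a₂)) := by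
    rw [neg_sub, Real.rpow_sub hB0, Real.rpow_one]; ring
  have h4 : (A ^ 2)⁻¹ * S.trunc (r / A) + S.trunc (r * A) ≤ 1 / 2 * S.trunc r :=
    calc _ ≤ (A ^ 2)⁻¹ * (q * (A ^ 2) ^ S.a₂ * S.trunc r) + q * (A ^ 2) ^ (-S.a₁) * S.trunc r := by
          gcongr
      _ = q * ((A ^ 2) ^ (-(1 - S.a₂)) + (A ^ 2) ^ (-S.a₁)) * S.trunc r := by rw [← h3]; ring
      _ ≤ _ := by gcongr
  linarith

lemma exists_le_j (hd : 2 ≤ d) : ∃ s₀ c : ℝ, 0 < s₀ ∧ 0 < c ∧ ∀ s, 0 < s → s ≤ s₀ →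
    c * S.trunc s ≤ S.j s * s ^ d := by
  obtain ⟨A, hA, h⟩ := S.exists_trunc_annulus hd
  have hA0 : 0 < A := by linarith
  have : Nonempty (Fin d) := ⟨⟨0, by omega⟩⟩
  set ω := (volume (ball (0 : Rd d) 1)).toReal
  have hω : 0 < ω := ENNReal.toReal_pos (measure_ball_pos _ _ one_pos).ne' measure_ball_lt_top.ne
  refine ⟨(A ^ 2)⁻¹, (2 * A ^ 2 * (A ^ 2) ^ d * ω)⁻¹, by positivity, by positivity,
    fun s hs hs' => ?_⟩
  have h1 := h (s * A) (by positivity) (by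
    rw [mul_assoc, ← sq]
    calc s * A ^ 2 ≤ (A ^ 2)⁻¹ * A ^ 2 := by gcongr
      _ = 1 := by field_simp)
  have h2 := S.levy_annulus_le hd (r := s) (R := s * A * A) hs (by
    nlinarith [mul_pos hs (sub_pos.2 hA), mul_pos (mul_pos hs hA0) (sub_pos.2 hA)])
  have h3 := ENNReal.toReal_mono (ENNReal.mul_lt_top ENNReal.ofReal_lt_top (ENNReal.mul_lt_top
    ENNReal.ofReal_lt_top measure_ball_lt_top)).ne h2
  rw [ENNReal.toReal_mul, ENNReal.toReal_mul, ENNReal.toReal_ofReal (S.j_nonneg _),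
    ENNReal.toReal_ofReal (by positivity)] at h3
  rw [mul_div_cancel_right₀ _ hA0.ne'] at h1
  have h4 := S.trunc_le hd hs hA.le
  rw [inv_mul_le_iff₀ (by positivity)]
  calc S.trunc s ≤ A ^ 2 * (2 * (S.j s * ((s * A * A) ^ d * ω))) := by
        refine h4.trans ?_
        gcongr
        exact h1.trans (by gcongr)
    _ = _ := by rw [mul_assoc s, mul_pow, ← sq]; ring

lemma levy_univ (hd : 2 ≤ d) : S.levy univ = ∞ := by
  by_contra hne
  have : IsFiniteMeasure S.levy := ⟨lt_top_iff_ne_top.2 hne⟩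
  have h : ∀ᶠ δ in 𝓝[>] (0 : ℝ), S.levy.real univ < S.trunc δ :=
    (S.tendsto_trunc hd).eventually_gt_atTop _
  obtain ⟨δ, hδ, hδ0⟩ := (h.and self_mem_nhdsWithin).exists
  refine hδ.not_ge ?_
  calc S.trunc δ ≤ ∫ _, (1 : ℝ) ∂S.levy :=
        integral_mono (S.integrable_trunc hd hδ0) (integrable_const _) fun z => min_le_left _ _
    _ = _ := by simp

lemma levy_halfSpace_zero (hd : 2 ≤ d) {e : Rd d} (he : ‖e‖ = 1) :
    S.levy {z | 0 < ⟪z, e⟫} = ∞ := by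
  have hsym : S.levy {z | ⟪z, e⟫ < 0} = S.levy {z | 0 < ⟪z, e⟫} := by
    have hm : MeasurableSet {z : Rd d | 0 < ⟪z, e⟫} :=
      measurableSet_lt measurable_const (by fun_prop)
    rw [← (S.measurePreserving_levy (LinearIsometryEquiv.neg ℝ)).measure_preimage
      hm.nullMeasurableSet]
    congr 1
    ext z
    simp [inner_neg_left]
  have hzero : S.levy {z | ⟪z, e⟫ = 0} = 0 := by
    refine (withDensity_absolutelyContinuous _ _) ?_
    have h := Measure.addHaar_submodule (volume : Measure (Rd d)) (ℝ ∙ e)ᗮ (by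
      intro h
      have : e ∈ (ℝ ∙ e)ᗮ := h ▸ Submodule.mem_top
      rw [Submodule.mem_orthogonal_singleton_iff_inner_left, real_inner_self_eq_norm_sq, he] at this
      norm_num at this)
    convert h using 2
    ext z
    simp [Submodule.mem_orthogonal_singleton_iff_inner_left]
  have hcov : (univ : Set (Rd d)) ⊆ {z | 0 < ⟪z, e⟫} ∪ {z | ⟪z, e⟫ < 0} ∪ {z | ⟪z, e⟫ = 0} := by
    intro z _
    rcases lt_trichotomy 0 ⟪z, e⟫ with h | h | h
    · exact Or.inl (Or.inl h)
    · exact Or.inr h.symm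
    · exact Or.inl (Or.inr h)
  have h := (measure_mono (μ := S.levy) hcov).trans
    ((measure_union_le _ _).trans (add_le_add_left (measure_union_le _ _) _))
  rw [S.levy_univ hd, hsym, hzero, add_zero, top_le_iff, ENNReal.add_eq_top, or_self] at h
  exact h

lemma exists_levy_halfSpace (hd : 2 ≤ d) {e : Rd d} (he : ‖e‖ = 1) (N : ℝ) :
    ∃ s₀ > 0, ∀ s ≤ s₀, ENNReal.ofReal N < S.levy {z | s < ⟪z, e⟫} := by
  have hmono : Monotone fun n : ℕ => {z : Rd d | 1 / ((n : ℝ) + 1) < ⟪z, e⟫} := by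
    intro n m hnm z hz
    have hz : 1 / ((n : ℝ) + 1) < ⟪z, e⟫ := hz
    exact lt_of_le_of_lt (Nat.one_div_le_one_div hnm) hz
  have hU : ⋃ n : ℕ, {z : Rd d | 1 / ((n : ℝ) + 1) < ⟪z, e⟫} = {z | 0 < ⟪z, e⟫} := by
    ext z
    simp only [mem_iUnion]
    constructor
    · rintro ⟨n, hn⟩
      have hn : 1 / ((n : ℝ) + 1) < ⟪z, e⟫ := hn
      exact lt_trans Nat.one_div_pos_of_nat hn
    · intro (hz : 0 < ⟪z, e⟫)
      exact exists_nat_one_div_lt hz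
  have h := tendsto_measure_iUnion_atTop (μ := S.levy) hmono
  rw [hU, S.levy_halfSpace_zero hd he] at h
  obtain ⟨n, hn⟩ := (h.eventually_const_lt (ENNReal.ofReal_lt_top (r := N))).exists
  exact ⟨1 / ((n : ℝ) + 1), by positivity, fun s hs =>
    lt_of_lt_of_le hn (measure_mono fun z hz => lt_of_le_of_lt hs hz)⟩

/-- The supersolution inequality tested against paraboloids touching from below. -/
def ParabolicSuper (g u : Rd d → ℝ) : Prop :=
  ∀ (x p : Rd d) (A δ : ℝ), 0 < δ → δ ≤ 1 →
    (∀ z, ‖z‖ ≤ δ → u x + ⟪p, z⟫ - A * ‖z‖ ^ 2 ≤ u (x + z)) →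
    g x ≤ ∫ z in {z | δ < ‖z‖}, (u x - u (x + z)) ∂S.levy +
      A * ∫ z in {z | ‖z‖ ≤ δ}, ‖z‖ ^ 2 ∂S.levy

lemma measurableSet_norm_gt (δ : ℝ) : MeasurableSet {z : Rd d | δ < ‖z‖} :=
  measurableSet_lt measurable_const measurable_norm

lemma measurableSet_norm_le (δ : ℝ) : MeasurableSet {z : Rd d | ‖z‖ ≤ δ} :=
  measurableSet_le measurable_norm measurable_const

lemma integrableOn_norm_gt (hd : 2 ≤ d) {δ : ℝ} (hδ : 0 < δ) {g : Rd d → ℝ} (hg : Measurable g)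
    {M : ℝ} (hM : ∀ z, δ < ‖z‖ → |g z| ≤ M) : IntegrableOn g {z | δ < ‖z‖} S.levy :=
  Measure.integrableOn_of_bounded (S.levy_norm_gt_lt_top hd hδ).ne hg.aestronglyMeasurable
    (M := M) ((ae_restrict_iff' (measurableSet_norm_gt δ)).2 (Eventually.of_forall hM))

lemma integrableOn_norm_le (hd : 2 ≤ d) {δ : ℝ} (hδ : 0 < δ) :
    IntegrableOn (fun z : Rd d => ‖z‖ ^ 2) {z | ‖z‖ ≤ δ} S.levy := by
  have h := ((S.integrable_trunc hd hδ).const_mul (δ ^ 2)).integrableOn (s := {z | ‖z‖ ≤ δ})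
  refine h.congr_fun (fun z (hz : ‖z‖ ≤ δ) => ?_) (measurableSet_norm_le δ)
  have : ‖z‖ ^ 2 / δ ^ 2 ≤ 1 := by rw [div_le_one (by positivity)]; gcongr
  simp only [min_eq_right this]
  field_simp

/-- A cut-off which is `1` on the ball of radius `δ / 2` and `0` outside the ball of radius `δ`. -/
def cutoff (δ : ℝ) (z : Rd d) : ℝ := max 0 (min 1 (2 - 2 * ‖z‖ / δ))

lemma continuous_cutoff (δ : ℝ) : Continuous (cutoff δ : Rd d → ℝ) := by
  unfold cutoff; fun_prop

lemma cutoff_mem (δ : ℝ) (z : Rd d) : 0 ≤ cutoff δ z ∧ cutoff δ z ≤ 1 :=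
  ⟨le_max_left _ _, max_le zero_le_one (min_le_left _ _)⟩

lemma cutoff_eq_one {δ : ℝ} (hδ : 0 < δ) {z : Rd d} (hz : ‖z‖ ≤ δ / 2) : cutoff δ z = 1 := by
  have : 2 * ‖z‖ / δ ≤ 1 := by rw [div_le_one hδ]; linarith
  rw [cutoff, min_eq_left (by linarith), max_eq_right zero_le_one]

lemma cutoff_eq_zero {δ : ℝ} (hδ : 0 < δ) {z : Rd d} (hz : δ ≤ ‖z‖) : cutoff δ z = 0 := by
  have : 2 ≤ 2 * ‖z‖ / δ := by rw [le_div_iff₀ hδ]; linarith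
  exact max_eq_left ((min_le_right _ _).trans (by linarith))

lemma hasGradientAt_paraboloid (x p : Rd d) (a A : ℝ) :
    HasGradientAt (fun y => a + ⟪p, y - x⟫ - A * ‖y - x‖ ^ 2) p x := by
  rw [hasGradientAt_iff_hasFDerivAt]
  have h1 : HasFDerivAt (fun y : Rd d => y - x) (ContinuousLinearMap.id ℝ (Rd d)) x :=
    (hasFDerivAt_id x).sub_const x
  have h2 := (h1.norm_sq.const_mul A)
  have h3 := ((innerSL ℝ p).hasFDerivAt.comp x h1).const_add a
  refine (h3.sub h2).congr_fderiv ?_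
  ext v
  simp

/-- The test function glueing a paraboloid near `x` with `u` away from `x`. -/
def glue (u : Rd d → ℝ) (x p : Rd d) (A δ ε : ℝ) (y : Rd d) : ℝ :=
  cutoff δ (y - x) * (u x + ⟪p, y - x⟫ - A * ‖y - x‖ ^ 2) + (1 - cutoff δ (y - x)) * u y -
    ε * min 1 (‖y - x‖ ^ 2)

lemma continuous_glue {u : Rd d → ℝ} (hu : Continuous u) (x p : Rd d) (A δ ε : ℝ) :
    Continuous (glue u x p A δ ε) := by
  unfold glue
  have := (continuous_cutoff δ).comp (continuous_id.sub (continuous_const (y := x)))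
  simp only [Function.comp_def] at this
  fun_prop

lemma glue_self (u : Rd d → ℝ) (x p : Rd d) (A : ℝ) {δ : ℝ} (hδ : 0 < δ) (ε : ℝ) :
    glue u x p A δ ε x = u x := by
  rw [glue, sub_self, cutoff_eq_one hδ (by rw [norm_zero]; positivity)]; simp

lemma glue_of_le (u : Rd d → ℝ) (x p : Rd d) (A : ℝ) {δ : ℝ} (hδ : 0 < δ) (hδ1 : δ ≤ 1) (ε : ℝ)
    {y : Rd d} (hy : ‖y - x‖ ≤ δ / 2) :
    glue u x p A δ ε y = u x + ⟪p, y - x⟫ - (A + ε) * ‖y - x‖ ^ 2 := by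
  have : ‖y - x‖ ^ 2 ≤ 1 := pow_le_one₀ (norm_nonneg _) (by linarith)
  rw [glue, cutoff_eq_one hδ hy, min_eq_right this]; ring

lemma glue_of_ge (u : Rd d → ℝ) (x p : Rd d) (A : ℝ) {δ : ℝ} (hδ : 0 < δ) (ε : ℝ)
    {y : Rd d} (hy : δ ≤ ‖y - x‖) :
    glue u x p A δ ε y = u y - ε * min 1 (‖y - x‖ ^ 2) := by
  rw [glue, cutoff_eq_zero hδ hy]; ring

lemma parabola_le_glue {u : Rd d → ℝ} {x p : Rd d} {A δ : ℝ} (ε : ℝ) {y : Rd d}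
    (h : u x + ⟪p, y - x⟫ - A * ‖y - x‖ ^ 2 ≤ u y) :
    u x + ⟪p, y - x⟫ - A * ‖y - x‖ ^ 2 - ε * min 1 (‖y - x‖ ^ 2) ≤ glue u x p A δ ε y := by
  have := (cutoff_mem δ (y - x)).2
  rw [glue]; nlinarith

lemma glue_le {u : Rd d → ℝ} {x p : Rd d} {A δ : ℝ} (ε : ℝ) {y : Rd d}
    (h : u x + ⟪p, y - x⟫ - A * ‖y - x‖ ^ 2 ≤ u y) :
    glue u x p A δ ε y ≤ u y - ε * min 1 (‖y - x‖ ^ 2) := by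
  have := (cutoff_mem δ (y - x)).1
  rw [glue]; nlinarith

lemma glue_bounded {u : Rd d → ℝ} {M : ℝ} (hM : ∀ y, |u y| ≤ M) (x p : Rd d) (A : ℝ) {δ : ℝ}
    (hδ : 0 < δ) (hδ1 : δ ≤ 1) {ε : ℝ} (hε : 0 < ε) (y : Rd d) :
    |glue u x p A δ ε y| ≤ (M + ‖p‖ + |A|) + M + ε := by
  have hM0 : 0 ≤ M := (abs_nonneg _).trans (hM x)
  have hmin : |min 1 (‖y - x‖ ^ 2)| ≤ 1 := by
    rw [abs_of_nonneg (by positivity)]; exact min_le_left _ _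
  obtain ⟨h0, h1⟩ := cutoff_mem δ (y - x)
  have hq : |cutoff δ (y - x) * (u x + ⟪p, y - x⟫ - A * ‖y - x‖ ^ 2)| ≤ M + ‖p‖ + |A| := by
    rcases le_or_gt δ ‖y - x‖ with h | h
    · rw [cutoff_eq_zero hδ h, zero_mul, abs_zero]; positivity
    · rw [abs_mul, abs_of_nonneg h0]
      refine (mul_le_of_le_one_left (abs_nonneg _) h1).trans ?_
      refine (abs_sub _ _).trans (add_le_add ((abs_add_le _ _).trans (add_le_add (hM x) ?_)) ?_)
      · exact (abs_real_inner_le_norm _ _).trans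
          (mul_le_of_le_one_right (norm_nonneg _) (by linarith))
      · rw [abs_mul, abs_of_nonneg (sq_nonneg ‖y - x‖)]
        exact mul_le_of_le_one_right (abs_nonneg _) (pow_le_one₀ (norm_nonneg _) (by linarith))
  have h2 : |(1 - cutoff δ (y - x)) * u y| ≤ M := by
    rw [abs_mul, abs_of_nonneg (by linarith)]
    exact (mul_le_of_le_one_left (abs_nonneg _) (by linarith)).trans (hM y)
  have h3 : |ε * min 1 (‖y - x‖ ^ 2)| ≤ ε := by
    rw [abs_mul, abs_of_pos hε]; exact mul_le_of_le_one_right hε.le hmin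
  exact (abs_sub _ _).trans (add_le_add ((abs_add_le _ _).trans (add_le_add hq h2)) h3)

lemma testAt_glue {u : Rd d → ℝ} (hu : Continuous u) {M : ℝ} (hM : ∀ y, |u y| ≤ M) (x p : Rd d)
    (A : ℝ) {δ : ℝ} (hδ : 0 < δ) (hδ1 : δ ≤ 1) {ε : ℝ} (hε : 0 < ε) :
    TestAt x (glue u x p A δ ε) := by
  refine ⟨⟨_, glue_bounded hM x p A hδ hδ1 hε⟩, continuous_glue hu .., ball x (δ / 2),
    ball_mem_nhds x (by positivity), ?_⟩
  have h : ContDiff ℝ 2 fun y => u x + ⟪p, y - x⟫ - (A + ε) * ‖y - x‖ ^ 2 := by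
    have h1 : ContDiff ℝ 2 fun y : Rd d => y - x := contDiff_id.sub contDiff_const
    exact (contDiff_const.add (contDiff_const.inner ℝ h1)).sub
      (contDiff_const.mul (h1.norm_sq ℝ))
  refine h.contDiffOn.congr fun y hy => glue_of_le u x p A hδ hδ1 ε ?_
  rw [mem_ball, dist_eq_norm] at hy
  exact hy.le

lemma gradient_glue (u : Rd d → ℝ) (x p : Rd d) (A : ℝ) {δ : ℝ} (hδ : 0 < δ) (hδ1 : δ ≤ 1)
    (ε : ℝ) : gradient (glue u x p A δ ε) x = p := by
  refine HasGradientAt.gradient ((hasGradientAt_paraboloid x p (u x) (A + ε)).congr_of_eventuallyEq ?_)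
  filter_upwards [ball_mem_nhds x (show 0 < δ / 2 by positivity)] with y hy
  rw [mem_ball, dist_eq_norm] at hy
  exact glue_of_le u x p A hδ hδ1 ε hy.le

lemma psiOp_glue_le (hd : 2 ≤ d) {u : Rd d → ℝ} (hu : Continuous u) {M : ℝ}
    (hM : ∀ y, |u y| ≤ M) {x p : Rd d} {A δ : ℝ} (hδ : 0 < δ) (hδ1 : δ ≤ 1) {ε : ℝ} (hε : 0 < ε)
    (h : ∀ z, ‖z‖ ≤ δ → u x + ⟪p, z⟫ - A * ‖z‖ ^ 2 ≤ u (x + z)) :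
    psiOp S (glue u x p A δ ε) x ≤ ∫ z in {z | δ < ‖z‖}, (u x - u (x + z)) ∂S.levy +
      A * (∫ z in {z | ‖z‖ ≤ δ}, ‖z‖ ^ 2 ∂S.levy) + ε * S.trunc 1 := by
  have hM0 : 0 ≤ M := (abs_nonneg _).trans (hM x)
  set φ := glue u x p A δ ε with hφ
  set G : Rd d → ℝ := fun z => φ x - φ (x + z) + (if ‖z‖ ≤ 1 then ⟪z, p⟫ else 0)
  have hpsi : psiOp S φ x = ∫ z, G z ∂S.levy := by
    rw [psiOp, hφ, gradient_glue u x p A hδ hδ1 ε, integral_levy]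
  have hGm : Measurable G := by
    have := (continuous_glue hu x p A δ ε).measurable
    refine (measurable_const.sub (this.comp (measurable_const.add measurable_id))).add
      (Measurable.ite (measurableSet_norm_le 1) (by fun_prop) measurable_const)
  set C := (M + ‖p‖ + |A|) + M + ε
  have hC : 0 ≤ C := by positivity
  have hi : ∀ z : Rd d, |if ‖z‖ ≤ 1 then ⟪z, p⟫ else 0| ≤ ‖p‖ := by
    intro z
    split_ifs with hz
    · exact (abs_real_inner_le_norm _ _).trans (mul_le_of_le_one_left (norm_nonneg _) hz)
    · simp
  have hGi : Integrable G S.levy := by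
    refine S.integrable_levy hd hGm (C := |A + ε| + (2 * C + ‖p‖) * (4 / δ ^ 2)) fun z => ?_
    rcases le_or_gt ‖z‖ (δ / 2) with hz | hz
    · have e : G z = (A + ε) * ‖z‖ ^ 2 := by
        simp only [G, hφ]
        rw [glue_self u x p A hδ, glue_of_le u x p A hδ hδ1 ε (by simpa using hz),
          if_pos (by linarith), add_sub_cancel_left, real_inner_comm]
        ring
      have hz1 : ‖z‖ ^ 2 ≤ 1 := pow_le_one₀ (norm_nonneg _) (by linarith)
      rw [e, abs_mul, abs_of_nonneg (sq_nonneg ‖z‖), min_eq_right hz1]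
      have : 0 ≤ (2 * C + ‖p‖) * (4 / δ ^ 2) := by positivity
      gcongr
      linarith
    · have h1 : |G z| ≤ 2 * C + ‖p‖ := by
        refine (abs_add_le _ _).trans (add_le_add ((abs_sub _ _).trans ?_) (hi z))
        rw [two_mul]
        exact add_le_add (glue_bounded hM x p A hδ hδ1 hε x) (glue_bounded hM x p A hδ hδ1 hε _)
      have h2 : δ ^ 2 / 4 ≤ min 1 (‖z‖ ^ 2) := by
        refine le_min (by nlinarith) ?_
        calc δ ^ 2 / 4 = (δ / 2) ^ 2 := by ring
          _ ≤ _ := by gcongr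
      calc |G z| ≤ (2 * C + ‖p‖) * (4 / δ ^ 2) * (δ ^ 2 / 4) := by
            refine h1.trans (le_of_eq ?_); field_simp
        _ ≤ (2 * C + ‖p‖) * (4 / δ ^ 2) * min 1 (‖z‖ ^ 2) := by gcongr
        _ ≤ _ := by gcongr; exact le_add_of_nonneg_left (abs_nonneg _)
  set O : Rd d → ℝ := fun z => if δ < ‖z‖ then (if ‖z‖ ≤ 1 then ⟪z, p⟫ else 0) else 0
  have hO0 : ∫ z, O z ∂S.levy = 0 := S.integral_levy_of_odd fun z => by
    simp only [O, norm_neg, inner_neg_left]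
    split_ifs <;> simp
  have hOm : Measurable O := Measurable.ite (measurableSet_norm_gt δ)
    (Measurable.ite (measurableSet_norm_le 1) (by fun_prop) measurable_const) measurable_const
  have hOi : Integrable O S.levy := by
    refine S.integrable_levy hd hOm (C := ‖p‖ / δ ^ 2) fun z => ?_
    by_cases hz : δ < ‖z‖
    · simp only [O, if_pos hz]
      refine (hi z).trans ?_
      have h2 : δ ^ 2 ≤ min 1 (‖z‖ ^ 2) := le_min (pow_le_one₀ hδ.le hδ1) (by gcongr)
      calc ‖p‖ = ‖p‖ / δ ^ 2 * δ ^ 2 := by field_simp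
        _ ≤ _ := by gcongr
    · simp only [O, if_neg hz, abs_zero]; positivity
  have hI1 : IntegrableOn (fun z => u x - u (x + z)) {z | δ < ‖z‖} S.levy :=
    S.integrableOn_norm_gt hd hδ (by fun_prop) (M := M + M) fun z _ =>
      (abs_sub _ _).trans (add_le_add (hM _) (hM _))
  have hI1' := (integrable_indicator_iff (measurableSet_norm_gt δ)).2 hI1
  have hI2' := ((integrable_indicator_iff (measurableSet_norm_le δ)).2
    (S.integrableOn_norm_le hd hδ)).const_mul A
  have hI3 := (S.integrable_trunc hd one_pos).const_mul ε
  rw [hpsi]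
  calc ∫ z, G z ∂S.levy ≤ ∫ z, ((({z : Rd d | δ < ‖z‖}.indicator fun z => u x - u (x + z)) z +
        A * ({z : Rd d | ‖z‖ ≤ δ}.indicator fun z => ‖z‖ ^ 2) z) +
          ε * min 1 (‖z‖ ^ 2 / 1 ^ 2)) + O z ∂S.levy := by
        refine integral_mono hGi (((hI1'.add hI2').add hI3).add hOi) fun z => ?_
        show φ x - φ (x + z) + (if ‖z‖ ≤ 1 then ⟪z, p⟫ else 0) ≤ _
        rw [hφ, glue_self u x p A hδ]
        simp only [O]
        rcases le_or_gt ‖z‖ δ with hz | hz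
        · rw [if_pos (hz.trans hδ1), indicator_of_notMem (by simpa using hz),
            indicator_of_mem (by simpa using hz), if_neg (by linarith)]
          have := parabola_le_glue (u := u) (x := x) (p := p) (A := A) (δ := δ) ε (y := x + z)
            (by simpa using h z hz)
          rw [add_sub_cancel_left, real_inner_comm] at this
          simp only [one_pow, div_one]
          linarith
        · rw [indicator_of_mem (by simpa using hz), indicator_of_notMem (by simpa using hz),
            if_pos hz, glue_of_ge u x p A hδ ε (by simpa using hz.le), add_sub_cancel_left]
          simp only [one_pow, div_one]
          linarith
    _ = _ := by
        have e1 := integral_add ((hI1'.add hI2').add hI3) hOi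
        have e2 := integral_add (hI1'.add hI2') hI3
        have e3 := integral_add hI1' hI2'
        simp only [Pi.add_apply] at e1 e2 e3
        rw [e1, e2, e3, hO0, integral_const_mul, integral_const_mul,
          integral_indicator (measurableSet_norm_gt δ),
          integral_indicator (measurableSet_norm_le δ), add_zero]
        rfl

lemma parabolicSuper_of_test (hd : 2 ≤ d) {g u : Rd d → ℝ} (hu : Continuous u) {M : ℝ}
    (hM : ∀ y, |u y| ≤ M)
    (h : ∀ x φ, TestAt x φ → φ x = u x → (∀ y, y ≠ x → φ y < u y) → g x ≤ psiOp S φ x) :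
    S.ParabolicSuper g u := by
  intro x p A δ hδ hδ1 hq
  have key : ∀ ε > 0, g x ≤ ∫ z in {z | δ < ‖z‖}, (u x - u (x + z)) ∂S.levy +
      A * (∫ z in {z | ‖z‖ ≤ δ}, ‖z‖ ^ 2 ∂S.levy) + ε * S.trunc 1 := by
    intro ε hε
    refine (h x _ (testAt_glue hu hM x p A hδ hδ1 hε) (glue_self u x p A hδ ε) ?_).trans
      (S.psiOp_glue_le hd hu hM hδ hδ1 hε hq)
    intro y hy
    have hy' : 0 < ‖y - x‖ := norm_pos_iff.2 (sub_ne_zero.2 hy)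
    have hpos : 0 < ε * min 1 (‖y - x‖ ^ 2) := by positivity
    rcases le_or_gt ‖y - x‖ δ with hz | hz
    · have := glue_le (δ := δ) ε (y := y) (by simpa using hq (y - x) hz)
      linarith
    · rw [glue_of_ge u x p A hδ ε hz.le]; linarith
  refine le_of_forall_pos_le_add fun ε hε => ?_
  have h0 := S.trunc_nonneg 1
  refine (key (ε / (S.trunc 1 + 1)) (by positivity)).trans ?_
  gcongr
  rw [div_mul_eq_mul_div, div_le_iff₀ (by positivity)]
  nlinarith

lemma psiOp_neg (φ : Rd d → ℝ) (x : Rd d) : psiOp S (fun y => -φ y) x = -psiOp S φ x := by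
  have hg : gradient (fun y => -φ y) x = -gradient φ x := by
    simp [gradient, fderiv_fun_neg]
  rw [psiOp, psiOp, ← integral_neg, hg]
  refine integral_congr_ae (Eventually.of_forall fun z => ?_)
  simp only [inner_neg_right]
  split_ifs <;> ring

lemma _root_.IsSuperSol.parabolicSuper {S : PsiSetting d} (hd : 2 ≤ d) {g u : Rd d → ℝ}
    (hu : Continuous u) {M : ℝ} (hM : ∀ y, |u y| ≤ M)
    (h : IsSuperSol S univ (fun _ => 0) g u) : S.ParabolicSuper g u :=
  S.parabolicSuper_of_test hd hu hM fun x φ h1 h2 h3 => by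
    simpa using h.2 x (mem_univ x) φ h1 h2 h3

lemma _root_.IsSubSol.parabolicSuper {S : PsiSetting d} (hd : 2 ≤ d) {g u : Rd d → ℝ}
    (hu : Continuous u) {M : ℝ} (hM : ∀ y, |u y| ≤ M)
    (h : IsSubSol S univ (fun _ => 0) g u) :
    S.ParabolicSuper (fun x => -g x) (fun x => -u x) :=
  S.parabolicSuper_of_test hd hu.neg (by simpa using hM) fun x φ h1 h2 h3 => by
    obtain ⟨⟨M', hM'⟩, hc, U, hU, hφU⟩ := h1
    have := h.2 x (mem_univ x) (fun y => -φ y) ⟨⟨M', by simpa using hM'⟩, hc.neg, U, hU, hφU.neg⟩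
      (by simp [h2]) fun y hy => by linarith [h3 y hy]
    rw [psiOp_neg] at this
    linarith

lemma ParabolicSuper.comp_isometry {S : PsiSetting d} {g u : Rd d → ℝ} (h : S.ParabolicSuper g u)
    (L : Rd d ≃ₗᵢ[ℝ] Rd d) (c : Rd d) :
    S.ParabolicSuper (fun x => g (L x + c)) (fun x => u (L x + c)) := by
  intro x p A δ hδ hδ1 hq
  refine (h (L x + c) (L p) A δ hδ hδ1 fun z hz => ?_).trans (le_of_eq ?_)
  · have := hq (L.symm z) (by simpa using hz)
    rw [← L.inner_map_map] at this
    simpa [add_right_comm] using this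
  · congr 1
    rw [← integral_indicator (measurableSet_norm_gt δ),
      ← integral_indicator (measurableSet_norm_gt δ), ← S.integral_levy_comp L]
    refine integral_congr_ae (Eventually.of_forall fun z => ?_)
    simp only [indicator_apply, Set.mem_ofPred_eq, L.norm_map, map_add, add_right_comm]

end PsiSetting

namespace PsiSetting

variable {d : ℕ} {S : PsiSetting d}

lemma tendsto_integral_norm_le (hd : 2 ≤ d) :
    Tendsto (fun δ : ℝ => ∫ z in {z | ‖z‖ ≤ δ}, ‖z‖ ^ 2 ∂S.levy) (𝓝[>] 0) (𝓝 0) := by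
  have h : Tendsto (fun δ : ℝ => ∫ z, {z : Rd d | ‖z‖ ≤ δ}.indicator (fun z => ‖z‖ ^ 2) z ∂S.levy)
      (𝓝[>] 0) (𝓝 (∫ _, (0 : ℝ) ∂S.levy)) := by
    refine tendsto_integral_filter_of_dominated_convergence (fun z : Rd d => min 1 (‖z‖ ^ 2)) ?_ ?_
      (S.integrable_min_one hd) ?_
    · exact Eventually.of_forall fun δ =>
        ((by fun_prop : Measurable fun z : Rd d => ‖z‖ ^ 2).indicator
          (measurableSet_norm_le δ)).aestronglyMeasurable
    · filter_upwards [Ioc_mem_nhdsGT one_pos] with δ hδ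
      refine Eventually.of_forall fun z => ?_
      by_cases hz : ‖z‖ ≤ δ
      · have h1 : ‖z‖ ^ 2 ≤ 1 := pow_le_one₀ (norm_nonneg _) (hz.trans hδ.2)
        rw [indicator_of_mem (by simpa using hz), min_eq_right h1]
        simp
      · rw [indicator_of_notMem (by simpa using hz), norm_zero]
        positivity
    · refine Eventually.of_forall fun z => ?_
      rcases eq_or_ne z 0 with rfl | hz
      · refine tendsto_const_nhds.congr fun δ => ?_
        simp [indicator_apply]
      · refine tendsto_const_nhds.congr' ?_
        filter_upwards [Ioo_mem_nhdsGT (norm_pos_iff.2 hz)] with δ hδ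
        rw [indicator_of_notMem (by simpa using hδ.2)]
  simpa only [integral_zero, integral_indicator (measurableSet_norm_le _)] using h

lemma ParabolicSuper.add_le_of_paraboloids (hd : 2 ≤ d) {a b ga gb : Rd d → ℝ}
    (ha : S.ParabolicSuper ga a) (hb : S.ParabolicSuper gb b) (hac : Continuous a)
    (hbc : Continuous b) {M : ℝ} (haM : ∀ x, |a x| ≤ M) (hbM : ∀ x, |b x| ≤ M)
    {x y p q s : Rd d} {A B η r : ℝ} (hr : 0 < r) (hr1 : r ≤ 1)
    (h1 : ∀ z, ‖z‖ ≤ r → a x + ⟪p, z⟫ - A * ‖z‖ ^ 2 ≤ a (x + z))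
    (h2 : ∀ z, ‖z‖ ≤ r → b y + ⟪q, z⟫ - B * ‖z‖ ^ 2 ≤ b (y + z))
    (h3 : ∀ z, ‖z‖ ≤ r → a x + b y + ⟪s, z⟫ - η * ‖z‖ ^ 2 ≤ a (x + z) + b (y + z))
    (hη : 0 ≤ η) :
    ga x + gb y ≤ ∫ z in {z | r < ‖z‖}, (a x + b y - (a (x + z) + b (y + z))) ∂S.levy +
      η * ∫ z in {z | ‖z‖ ≤ r}, ‖z‖ ^ 2 ∂S.levy := by
  have hw : ∀ z, |a x + b y - (a (x + z) + b (y + z))| ≤ M + M + (M + M) := fun z =>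
    (abs_sub _ _).trans (add_le_add ((abs_add_le _ _).trans (add_le_add (haM _) (hbM _)))
      ((abs_add_le _ _).trans (add_le_add (haM _) (hbM _))))
  have key : ∀ δ, 0 < δ → δ ≤ r → ga x + gb y ≤
      ∫ z in {z | r < ‖z‖}, (a x + b y - (a (x + z) + b (y + z))) ∂S.levy +
      η * (∫ z in {z | ‖z‖ ≤ r}, ‖z‖ ^ 2 ∂S.levy) +
      (A + B) * ∫ z in {z | ‖z‖ ≤ δ}, ‖z‖ ^ 2 ∂S.levy := by
    intro δ hδ hδr
    have ea := ha x p A δ hδ (hδr.trans hr1) fun z hz => h1 z (hz.trans hδr)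
    have eb := hb y q B δ hδ (hδr.trans hr1) fun z hz => h2 z (hz.trans hδr)
    have ia : IntegrableOn (fun z => a x - a (x + z)) {z | δ < ‖z‖} S.levy :=
      S.integrableOn_norm_gt hd hδ (by fun_prop) (M := M + M) fun z _ =>
        (abs_sub _ _).trans (add_le_add (haM _) (haM _))
    have ib : IntegrableOn (fun z => b y - b (y + z)) {z | δ < ‖z‖} S.levy :=
      S.integrableOn_norm_gt hd hδ (by fun_prop) (M := M + M) fun z _ =>
        (abs_sub _ _).trans (add_le_add (hbM _) (hbM _))
    have iw : IntegrableOn (fun z => a x + b y - (a (x + z) + b (y + z))) {z | δ < ‖z‖} S.levy :=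
      S.integrableOn_norm_gt hd hδ (by fun_prop) fun z _ => hw z
    have e1 : ∫ z in {z | δ < ‖z‖}, (a x - a (x + z)) ∂S.levy +
        ∫ z in {z | δ < ‖z‖}, (b y - b (y + z)) ∂S.levy =
        ∫ z in {z | δ < ‖z‖}, (a x + b y - (a (x + z) + b (y + z))) ∂S.levy := by
      rw [← integral_add ia ib]
      exact integral_congr_ae (Eventually.of_forall fun z => by ring)
    have e2 : {z : Rd d | δ < ‖z‖} = {z | r < ‖z‖} ∪ {z | δ < ‖z‖ ∧ ‖z‖ ≤ r} := by
      ext z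
      simp only [mem_union, Set.mem_ofPred_eq]
      constructor
      · intro h
        rcases lt_or_ge r ‖z‖ with h' | h'
        exacts [Or.inl h', Or.inr ⟨h, h'⟩]
      · rintro (h | h)
        exacts [hδr.trans_lt h, h.1]
    have hmeas : MeasurableSet {z : Rd d | δ < ‖z‖ ∧ ‖z‖ ≤ r} :=
      (measurableSet_norm_gt δ).inter (measurableSet_norm_le r)
    have e3 : ∫ z in {z | δ < ‖z‖}, (a x + b y - (a (x + z) + b (y + z))) ∂S.levy =
        ∫ z in {z | r < ‖z‖}, (a x + b y - (a (x + z) + b (y + z))) ∂S.levy +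
        ∫ z in {z | δ < ‖z‖ ∧ ‖z‖ ≤ r}, (a x + b y - (a (x + z) + b (y + z))) ∂S.levy := by
      rw [e2] at iw ⊢
      refine setIntegral_union ?_ hmeas iw.left_of_union iw.right_of_union
      rw [Set.disjoint_left]
      exact fun z (hz : r < ‖z‖) hz' => absurd hz'.2 (not_le.2 hz)
    have hsub : {z : Rd d | δ < ‖z‖ ∧ ‖z‖ ≤ r} ⊆ {z | δ < ‖z‖} := fun z hz => hz.1
    have hsub' : {z : Rd d | δ < ‖z‖ ∧ ‖z‖ ≤ r} ⊆ {z | ‖z‖ ≤ r} := fun z hz => hz.2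
    have is : IntegrableOn (fun z => ⟪s, z⟫) {z | δ < ‖z‖ ∧ ‖z‖ ≤ r} S.levy := by
      refine Measure.integrableOn_of_bounded (M := ‖s‖ * r)
        ((measure_mono hsub).trans_lt (S.levy_norm_gt_lt_top hd hδ)).ne
        (by fun_prop : Measurable fun z => ⟪s, z⟫).aestronglyMeasurable
        ((ae_restrict_iff' hmeas).2 (Eventually.of_forall fun z hz => ?_))
      exact (norm_inner_le_norm _ _).trans (by gcongr; exact hz.2)
    have iq : IntegrableOn (fun z : Rd d => η * ‖z‖ ^ 2) {z | ‖z‖ ≤ r} S.levy :=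
      (S.integrableOn_norm_le hd hr).const_mul η
    have e4 : ∫ z in {z | δ < ‖z‖ ∧ ‖z‖ ≤ r}, ⟪s, z⟫ ∂S.levy = 0 := by
      rw [← integral_indicator hmeas]
      refine S.integral_levy_of_odd fun z => ?_
      simp only [indicator_apply, Set.mem_ofPred_eq, norm_neg, inner_neg_right]
      split_ifs <;> simp
    have e5 : ∫ z in {z | δ < ‖z‖ ∧ ‖z‖ ≤ r}, (a x + b y - (a (x + z) + b (y + z))) ∂S.levy ≤
        η * ∫ z in {z | ‖z‖ ≤ r}, ‖z‖ ^ 2 ∂S.levy := by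
      calc _ ≤ ∫ z in {z | δ < ‖z‖ ∧ ‖z‖ ≤ r}, (η * ‖z‖ ^ 2 + -⟪s, z⟫) ∂S.levy := by
            refine setIntegral_mono_on (iw.mono_set hsub) ((iq.mono_set hsub').add is.neg) hmeas
              fun z hz => ?_
            have := h3 z hz.2
            linarith
        _ = ∫ z in {z | δ < ‖z‖ ∧ ‖z‖ ≤ r}, η * ‖z‖ ^ 2 ∂S.levy := by
            have e6 := integral_add (iq.mono_set hsub') is.neg
            simp only [Pi.neg_apply] at e6
            rw [e6, integral_neg, e4]
            simp
        _ ≤ ∫ z in {z | ‖z‖ ≤ r}, η * ‖z‖ ^ 2 ∂S.levy := by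
            refine setIntegral_mono_set iq ?_ hsub'.eventuallyLE
            exact Eventually.of_forall fun z => by
              show 0 ≤ η * ‖z‖ ^ 2
              positivity
        _ = _ := integral_const_mul _ _
    rw [e3] at e1
    linarith
  have hlim := ((tendsto_integral_norm_le (S := S) hd).const_mul (A + B)).const_add
    (∫ z in {z | r < ‖z‖}, (a x + b y - (a (x + z) + b (y + z))) ∂S.levy +
      η * (∫ z in {z | ‖z‖ ≤ r}, ‖z‖ ^ 2 ∂S.levy))
  rw [mul_zero, add_zero] at hlim
  refine ge_of_tendsto hlim ?_
  filter_upwards [Ioc_mem_nhdsGT hr] with δ hδ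
  exact key δ hδ.1 hδ.2

lemma exists_doubling_min {a b : Rd d → ℝ} (hac : Continuous a) (hbc : Continuous b)
    {x₀ : Rd d} {ρ : ℝ} (hρ : 0 < ρ)
    (hmin : ∀ y ∈ closedBall x₀ ρ, a x₀ + b x₀ ≤ a y + b y) {η : ℝ} (hη : 0 < η) {κ : ℝ}
    (hκ : 0 < κ) : ∃ (x y : Rd d) (n : ℝ), ‖x - x₀‖ < κ ∧ ‖y - x₀‖ < κ ∧ 
      ∀ x' ∈ closedBall x₀ ρ, ∀ y' ∈ closedBall x₀ ρ,
        a x + b y + n * ‖x - y‖ ^ 2 + η * ‖x - x₀‖ ^ 2 ≤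
          a x' + b y' + n * ‖x' - y'‖ ^ 2 + η * ‖x' - x₀‖ ^ 2 := by
  have hK : IsCompact (closedBall x₀ ρ) := isCompact_closedBall x₀ ρ
  have hx₀ : x₀ ∈ closedBall x₀ ρ := mem_closedBall_self hρ.le
  obtain ⟨Ma, hMa⟩ := hK.exists_bound_of_continuousOn hac.continuousOn
  obtain ⟨Mb, hMb⟩ := hK.exists_bound_of_continuousOn hbc.continuousOn
  have huc := hK.uniformContinuousOn_of_continuous hbc.continuousOn
  obtain ⟨τ, hτ, hτb⟩ := Metric.uniformContinuousOn_iff.1 huc (η * (κ / 2) ^ 2) (by positivity)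
  have hMa0 : 0 ≤ Ma := (norm_nonneg _).trans (hMa x₀ hx₀)
  have hMb0 : 0 ≤ Mb := (norm_nonneg _).trans (hMb x₀ hx₀)
  set σ := min τ (κ / 2) with hσ
  have hσ0 : 0 < σ := by positivity
  set n := (2 * Ma + 2 * Mb + 1) / σ ^ 2 with hn
  have hn0 : 0 < n := by positivity
  obtain ⟨⟨x, y⟩, ⟨hx, hy⟩, hxy⟩ := (hK.prod hK).exists_isMinOn ⟨(x₀, x₀), hx₀, hx₀⟩
    (f := fun P : Rd d × Rd d =>
      a P.1 + b P.2 + n * ‖P.1 - P.2‖ ^ 2 + η * ‖P.1 - x₀‖ ^ 2) (by fun_prop)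
  rw [isMinOn_iff] at hxy
  have h0 := hxy (x₀, x₀) ⟨hx₀, hx₀⟩
  simp only [sub_self, norm_zero] at h0
  have a1 := abs_le.1 (hMa x hx)
  have a2 := abs_le.1 (hMa x₀ hx₀)
  have b1 := abs_le.1 (hMb y hy)
  have b2 := abs_le.1 (hMb x₀ hx₀)
  have p1 : 0 ≤ η * ‖x - x₀‖ ^ 2 := by positivity
  have p2 : 0 ≤ n * ‖x - y‖ ^ 2 := by positivity
  have hclose : ‖x - y‖ < σ := by
    have h1 : n * ‖x - y‖ ^ 2 < n * σ ^ 2 := by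
      have : n * σ ^ 2 = 2 * Ma + 2 * Mb + 1 := by rw [hn]; field_simp
      rw [this]; linarith [a1.1, a2.2, b1.1, b2.2]
    exact lt_of_pow_lt_pow_left₀ 2 hσ0.le (lt_of_mul_lt_mul_left h1 hn0.le)
  have hb' := hτb x hx y hy (by rw [dist_eq_norm]; exact hclose.trans_le (min_le_left _ _))
  rw [Real.dist_eq] at hb'
  have hxx : ‖x - x₀‖ < κ / 2 := by
    have h1 : η * ‖x - x₀‖ ^ 2 < η * (κ / 2) ^ 2 := by
      have := hmin x hx
      have := (abs_lt.1 hb').2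
      linarith
    exact lt_of_pow_lt_pow_left₀ 2 (by positivity) (lt_of_mul_lt_mul_left h1 hη.le)
  refine ⟨x, y, n, by linarith, ?_, fun x' hx' y' hy' => hxy (x', y') ⟨hx', hy'⟩⟩
  calc ‖y - x₀‖ = ‖(x - x₀) - (x - y)‖ := by congr 1; abel
    _ ≤ ‖x - x₀‖ + ‖x - y‖ := norm_sub_le _ _
    _ < κ / 2 + κ / 2 := add_lt_add hxx (hclose.trans_le (min_le_right _ _))
    _ = κ := by ring

/-- At a local minimum of the sum of two supersolutions the supersolution inequality holds. -/
lemma ParabolicSuper.add_le_of_isLocalMin (hd : 2 ≤ d) {a b ga gb : Rd d → ℝ}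
    (ha : S.ParabolicSuper ga a) (hb : S.ParabolicSuper gb b) (hac : Continuous a)
    (hbc : Continuous b) {M : ℝ} (haM : ∀ x, |a x| ≤ M) (hbM : ∀ x, |b x| ≤ M) {x₀ : Rd d}
    (hga : ContinuousAt ga x₀) (hgb : ContinuousAt gb x₀) {δ : ℝ} (hδ : 0 < δ) (hδ1 : δ ≤ 1)
    (hmin : ∀ y ∈ closedBall x₀ (2 * δ), a x₀ + b x₀ ≤ a y + b y) :
    ga x₀ + gb x₀ ≤ ∫ z in {z | δ < ‖z‖}, (a x₀ + b x₀ - (a (x₀ + z) + b (x₀ + z))) ∂S.levy := by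
  set J := ∫ z in {z : Rd d | ‖z‖ ≤ δ}, ‖z‖ ^ 2 ∂S.levy with hJ
  have key : ∀ η > 0, ga x₀ + gb x₀ ≤
      ∫ z in {z | δ < ‖z‖}, (a x₀ + b x₀ - (a (x₀ + z) + b (x₀ + z))) ∂S.levy + η * J := by
    intro η hη
    choose x y n hx hy hxy using fun k : ℕ => exists_doubling_min hac hbc
      (show 0 < 2 * δ by positivity) hmin hη (κ := min δ (1 / ((k : ℝ) + 1))) (by positivity)
    have hlim (s : ℕ → Rd d) (hs : ∀ k, ‖s k - x₀‖ < min δ (1 / ((k : ℝ) + 1))) :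
        Tendsto s atTop (𝓝 x₀) := by
      rw [tendsto_iff_norm_sub_tendsto_zero]
      exact squeeze_zero (fun _ => norm_nonneg _)
        (fun k => (hs k).le.trans (min_le_right _ _)) tendsto_one_div_add_atTop_nhds_zero_nat
    have hxl := hlim x hx
    have hyl := hlim y hy
    have hball (s : ℕ → Rd d) (hs : ∀ k, ‖s k - x₀‖ < min δ (1 / ((k : ℝ) + 1))) (k : ℕ)
        (z : Rd d) (hz : ‖z‖ ≤ δ) : s k + z ∈ closedBall x₀ (2 * δ) := by
      rw [mem_closedBall, dist_eq_norm, add_sub_right_comm]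
      have := (hs k).le.trans (min_le_left _ _)
      exact (norm_add_le _ _).trans (by linarith)
    have hineq : ∀ k, ga (x k) + gb (y k) ≤
        ∫ z in {z | δ < ‖z‖}, (a (x k) + b (y k) - (a (x k + z) + b (y k + z))) ∂S.levy + η * J := by
      intro k
      have m1 := hball x hx k
      have m2 := hball y hy k
      have m10 := m1 0 (by simpa using hδ.le)
      have m20 := m2 0 (by simpa using hδ.le)
      rw [add_zero] at m10 m20
      refine ha.add_le_of_paraboloids hd hb hac hbc haM hbM hδ hδ1
        (p := -((2 * n k) • (x k - y k) + (2 * η) • (x k - x₀))) (q := (2 * n k) • (x k - y k))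
        (s := -((2 * η) • (x k - x₀))) (A := n k + η) (B := n k) ?_ ?_ ?_ hη.le
      · intro z hz
        have h := hxy k _ (m1 z hz) _ m20
        have e1 : x k + z - y k = (x k - y k) + z := by abel
        have e2 : x k + z - x₀ = (x k - x₀) + z := by abel
        rw [e1, e2, norm_add_sq_real, norm_add_sq_real (x k - x₀)] at h
        rw [inner_neg_left, inner_add_left, real_inner_smul_left, real_inner_smul_left]
        linarith
      · intro z hz
        have h := hxy k _ m10 _ (m2 z hz)
        have e1 : x k - (y k + z) = (x k - y k) - z := by abel
        rw [e1, norm_sub_sq_real (x k - y k)] at h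
        rw [real_inner_smul_left]
        linarith
      · intro z hz
        have h := hxy k _ (m1 z hz) _ (m2 z hz)
        have e2 : x k + z - x₀ = (x k - x₀) + z := by abel
        rw [add_sub_add_right_eq_sub, e2, norm_add_sq_real (x k - x₀)] at h
        rw [inner_neg_left, real_inner_smul_left]
        linarith
    have hI : Tendsto (fun k => ∫ z in {z | δ < ‖z‖},
        (a (x k) + b (y k) - (a (x k + z) + b (y k + z))) ∂S.levy) atTop
        (𝓝 (∫ z in {z | δ < ‖z‖}, (a x₀ + b x₀ - (a (x₀ + z) + b (x₀ + z))) ∂S.levy)) := by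
      refine tendsto_integral_of_dominated_convergence (fun _ => M + M + (M + M)) ?_ ?_ ?_ ?_
      · intro k
        exact (by fun_prop : Measurable fun z =>
          a (x k) + b (y k) - (a (x k + z) + b (y k + z))).aestronglyMeasurable
      · exact integrableOn_const (S.levy_norm_gt_lt_top hd hδ).ne
      · intro k
        exact Eventually.of_forall fun z => (abs_sub _ _).trans
          (add_le_add ((abs_add_le _ _).trans (add_le_add (haM _) (hbM _)))
            ((abs_add_le _ _).trans (add_le_add (haM _) (hbM _))))
      · refine Eventually.of_forall fun z => ?_
        exact (((hac.tendsto _).comp hxl).add ((hbc.tendsto _).comp hyl)).sub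
          (((hac.tendsto _).comp (hxl.add_const z)).add ((hbc.tendsto _).comp (hyl.add_const z)))
    exact le_of_tendsto_of_tendsto' ((hga.tendsto.comp hxl).add (hgb.tendsto.comp hyl))
      (hI.add_const _) hineq
  have hJ0 : 0 ≤ J := integral_nonneg fun z => by
    show 0 ≤ ‖z‖ ^ 2
    positivity
  refine le_of_forall_pos_le_add fun ε hε => ?_
  refine (key (ε / (J + 1)) (by positivity)).trans ?_
  gcongr
  rw [div_mul_eq_mul_div, div_le_iff₀ (by positivity)]
  nlinarith

/-- The volume of the unit ball. -/
def unitVol (d : ℕ) : ℝ := (volume (ball (0 : Rd d) 1)).toReal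

lemma unitVol_pos : 0 < unitVol d :=
  ENNReal.toReal_pos (measure_ball_pos _ _ one_pos).ne' measure_ball_lt_top.ne

lemma integral_norm_gt_add_le (hd : 2 ≤ d) {v : Rd d → ℝ} (hv : Measurable v) (hv0 : ∀ z, 0 ≤ v z)
    {M : ℝ} (hM : ∀ z, |v z| ≤ M) {δ R ρ m : ℝ} (hδ : 0 < δ) (hδR : δ ≤ R) (hρ : 0 ≤ ρ)
    (hm : 0 ≤ m) {c : Rd d} (hE : ∀ z ∈ closedBall c ρ, δ < ‖z‖ ∧ ‖z‖ ≤ R ∧ m ≤ v z) :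
    ∫ z in {z | R < ‖z‖}, v z ∂S.levy + m * (S.j R * (ρ ^ d * unitVol d)) ≤
      ∫ z in {z | δ < ‖z‖}, v z ∂S.levy := by
  have hE0 : MeasurableSet (closedBall c ρ) := measurableSet_closedBall
  have iδ : IntegrableOn v {z | δ < ‖z‖} S.levy := S.integrableOn_norm_gt hd hδ hv fun z _ => hM z
  have hEs : closedBall c ρ ⊆ {z | δ < ‖z‖} := fun z hz => (hE z hz).1
  have hRs : {z : Rd d | R < ‖z‖} ⊆ {z | δ < ‖z‖} := fun z (hz : R < ‖z‖) => hδR.trans_lt hz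
  have hdisj : Disjoint {z : Rd d | R < ‖z‖} (closedBall c ρ) := by
    rw [Set.disjoint_left]
    exact fun z (hz : R < ‖z‖) hz' => absurd (hE z hz').2.1 (not_le.2 hz)
  have hlt : S.levy (closedBall c ρ) < ∞ :=
    (measure_mono hEs).trans_lt (S.levy_norm_gt_lt_top hd hδ)
  have h1 : S.j R * (ρ ^ d * unitVol d) ≤ (S.levy (closedBall c ρ)).toReal := by
    have h2 := S.le_levy hd (R := R) hE0 fun z hz =>
      ⟨norm_pos_iff.1 (hδ.trans (hE z hz).1), (hE z hz).2.1⟩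
    have h3 := ENNReal.toReal_mono hlt.ne h2
    rwa [volume_ball c hρ, ENNReal.toReal_mul, ENNReal.toReal_mul,
      ENNReal.toReal_ofReal (S.j_nonneg _), ENNReal.toReal_ofReal (by positivity)] at h3
  have h4 : m * (S.levy (closedBall c ρ)).toReal ≤ ∫ z in closedBall c ρ, v z ∂S.levy := by
    calc m * (S.levy (closedBall c ρ)).toReal = ∫ _ in closedBall c ρ, m ∂S.levy := by
          rw [setIntegral_const, smul_eq_mul, mul_comm, Measure.real]
      _ ≤ _ := setIntegral_mono_on (integrableOn_const hlt.ne) (iδ.mono_set hEs) hE0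
          fun z hz => (hE z hz).2.2
  calc _ ≤ ∫ z in {z | R < ‖z‖}, v z ∂S.levy + ∫ z in closedBall c ρ, v z ∂S.levy := by
        gcongr
        exact (mul_le_mul_of_nonneg_left h1 hm).trans h4
    _ = ∫ z in {z | R < ‖z‖} ∪ closedBall c ρ, v z ∂S.levy :=
        (setIntegral_union hdisj hE0 (iδ.mono_set hRs) (iδ.mono_set hEs)).symm
    _ ≤ _ := setIntegral_mono_set iδ (Eventually.of_forall hv0)
        (union_subset hRs hEs).eventuallyLE

lemma trunc_eq (hd : 2 ≤ d) {δ : ℝ} (hδ : 0 < δ) :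
    S.trunc δ = (S.levy {z | δ < ‖z‖}).toReal +
      (1 / δ ^ 2) * ∫ z in {z | ‖z‖ ≤ δ}, ‖z‖ ^ 2 ∂S.levy := by
  have h := integral_add_compl (measurableSet_norm_gt δ) (S.integrable_trunc hd hδ)
  rw [trunc, ← h]
  congr 1
  · rw [setIntegral_congr_fun (g := fun _ => (1 : ℝ)) (measurableSet_norm_gt δ)]
    · simp [Measure.real]
    · intro z (hz : δ < ‖z‖)
      refine min_eq_left ?_
      rw [one_le_div (by positivity)]
      gcongr
  · have e : {z : Rd d | δ < ‖z‖}ᶜ = {z | ‖z‖ ≤ δ} := by ext z; simp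
    rw [e, ← integral_const_mul]
    refine setIntegral_congr_fun (measurableSet_norm_le δ) fun z (hz : ‖z‖ ≤ δ) => ?_
    have : ‖z‖ ^ 2 / δ ^ 2 ≤ 1 := by rw [div_le_one (by positivity)]; gcongr
    show min 1 (‖z‖ ^ 2 / δ ^ 2) = _
    rw [min_eq_right this]; ring

lemma exists_forall_le_max {u : Rd d → ℝ} (hu : Continuous u) (h0 : ∀ x, 0 ≤ u x)
    (hdecay : Tendsto u (cocompact (Rd d)) (𝓝 0)) : ∃ z, ∀ y, u y ≤ u z := by
  by_cases h : ∃ x, u x ≠ 0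
  · obtain ⟨x, hx⟩ := h
    have hx : 0 < u x := lt_of_le_of_ne (h0 x) hx.symm
    exact hu.exists_forall_ge' x (hdecay.eventually_le_const hx)
  · push Not at h
    exact ⟨0, fun y => by rw [h, h]⟩

lemma exists_far_ball (hd : 2 ≤ d) {u : Rd d → ℝ} (hu : Continuous u) (h0 : ∀ x, 0 ≤ u x)
    (hdecay : Tendsto u (cocompact (Rd d)) (𝓝 0)) {ε τ : ℝ} (hε : 0 < ε) (hτ : 0 < τ) :
    ∃ x, ∀ y ∈ closedBall x 2, ∫ z in {z | 1 < ‖z‖}, u (y + z) ∂S.levy ≤ ε ∧ u y < τ := by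
  have : Nonempty (Fin d) := ⟨⟨0, by omega⟩⟩
  have : (cocompact (Rd d)).IsCountablyGenerated := by
    rw [← Metric.cobounded_eq_cocompact, ← comap_norm_atTop]; infer_instance
  obtain ⟨zM, hzM⟩ := exists_forall_le_max hu h0 hdecay
  have hI : Tendsto (fun y => ∫ z in {z | 1 < ‖z‖}, u (y + z) ∂S.levy) (cocompact (Rd d))
      (𝓝 (∫ z in {z : Rd d | 1 < ‖z‖}, (0 : ℝ) ∂S.levy)) := by
    refine tendsto_integral_filter_of_dominated_convergence (fun _ => u zM) ?_ ?_ ?_ ?_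
    · exact Eventually.of_forall fun y =>
        (by fun_prop : Measurable fun z => u (y + z)).aestronglyMeasurable
    · exact Eventually.of_forall fun y => Eventually.of_forall fun z => by
        rw [Real.norm_of_nonneg (h0 _)]; exact hzM _
    · exact integrableOn_const (S.levy_norm_gt_lt_top hd one_pos).ne
    · exact Eventually.of_forall fun z =>
        hdecay.comp (Homeomorph.addRight z).isClosedEmbedding.tendsto_cocompact
  rw [integral_zero] at hI
  have hev := (hI.eventually_le_const hε).and (hdecay.eventually_lt_const hτ)
  rw [← Metric.cobounded_eq_cocompact, ← comap_norm_atTop, Filter.eventually_comap] at hev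
  obtain ⟨N, hN⟩ := eventually_atTop.1 hev
  obtain ⟨x, hx⟩ := exists_norm_eq (Rd d) (show 0 ≤ max N 0 + 2 by positivity)
  refine ⟨x, fun y hy => hN ‖y‖ ?_ y rfl⟩
  rw [mem_closedBall, dist_comm, dist_eq_norm] at hy
  have h1 := norm_sub_norm_le x y
  have h2 := le_max_left N 0
  linarith

lemma exists_far (hd : 2 ≤ d) {f : ℝ → ℝ} {u : Rd d → ℝ} (hu : Continuous u) (h0 : ∀ x, 0 ≤ u x)
    (hdecay : Tendsto u (cocompact (Rd d)) (𝓝 0))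
    (hsub : S.ParabolicSuper (fun x => -f (u x)) (fun x => -u x)) {ε s : ℝ} (hε : 0 < ε)
    (hs : 0 < s) : ∃ y, u y ≤ s ∧ -ε ≤ f (u y) := by
  obtain ⟨zM, hzM⟩ := exists_forall_le_max hu h0 hdecay
  have hJ0 : 0 ≤ ∫ z in {z : Rd d | ‖z‖ ≤ 1}, ‖z‖ ^ 2 ∂S.levy := integral_nonneg fun z => by
    show 0 ≤ ‖z‖ ^ 2
    positivity
  obtain ⟨τ, hτ0, hτs, hτJ⟩ : ∃ τ, 0 < τ ∧ τ ≤ s ∧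
      τ * ∫ z in {z : Rd d | ‖z‖ ≤ 1}, ‖z‖ ^ 2 ∂S.levy ≤ ε / 4 := by
    generalize ∫ z in {z : Rd d | ‖z‖ ≤ 1}, ‖z‖ ^ 2 ∂S.levy = J at hJ0
    refine ⟨min s (ε / (4 * (J + 1))), by positivity, min_le_left _ _, ?_⟩
    calc min s (ε / (4 * (J + 1))) * J ≤ ε / (4 * (J + 1)) * (J + 1) :=
          mul_le_mul (min_le_right _ _) (by linarith) hJ0 (by positivity)
      _ = ε / 4 := by field_simp
  obtain ⟨x, hfar⟩ := exists_far_ball (S := S) hd hu h0 hdecay (half_pos hε) hτ0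
  obtain ⟨y, hy, hmax⟩ := (isCompact_closedBall x 2).exists_isMaxOn
    ⟨x, mem_closedBall_self zero_le_two⟩ (f := fun y => u y - τ * ‖y - x‖ ^ 2) (by fun_prop)
  rw [isMaxOn_iff] at hmax
  have hyx : ‖y - x‖ ≤ 1 := by
    have h1 := hmax x (mem_closedBall_self zero_le_two)
    simp only [sub_self, norm_zero] at h1
    have h2 := (hfar y hy).2
    have h3 := h0 x
    have h4 : τ * ‖y - x‖ ^ 2 ≤ τ * 1 := by linarith
    have h5 := le_of_mul_le_mul_left h4 hτ0
    nlinarith [norm_nonneg (y - x)]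
  refine ⟨y, (hfar y hy).2.le.trans hτs, ?_⟩
  have hT := hsub y (-((2 * τ) • (y - x))) τ 1 one_pos le_rfl fun z hz => by
    have h1 := hmax (y + z) (by
      rw [mem_closedBall, dist_eq_norm, add_sub_right_comm]
      exact (norm_add_le _ _).trans (by linarith))
    rw [add_sub_right_comm, norm_add_sq_real] at h1
    rw [inner_neg_left, real_inner_smul_left]
    linarith
  have i1 : IntegrableOn (fun z => u (y + z)) {z | 1 < ‖z‖} S.levy :=
    S.integrableOn_norm_gt hd one_pos (by fun_prop) (M := u zM) fun z _ => by
      rw [abs_of_nonneg (h0 _)]; exact hzM _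
  have i2 : IntegrableOn (fun z => -u y - -u (y + z)) {z | 1 < ‖z‖} S.levy :=
    S.integrableOn_norm_gt hd one_pos (by fun_prop) (M := u zM + u zM) fun z _ => by
      refine (abs_sub _ _).trans ?_
      rw [abs_neg, abs_neg, abs_of_nonneg (h0 _), abs_of_nonneg (h0 _)]
      exact add_le_add (hzM _) (hzM _)
  have h1 : ∫ z in {z | 1 < ‖z‖}, (-u y - -u (y + z)) ∂S.levy ≤
      ∫ z in {z | 1 < ‖z‖}, u (y + z) ∂S.levy :=
    integral_mono i2 i1 fun z => by
      have := h0 y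
      show -u y - -u (y + z) ≤ u (y + z)
      linarith
  have h3 := (hfar y hy).1
  linarith

lemma ParabolicSuper.integral_le_of_eq_zero {g u : Rd d → ℝ} (h : S.ParabolicSuper g u)
    (h0 : ∀ x, 0 ≤ u x) {x : Rd d} (hx : u x = 0) {δ : ℝ} (hδ : 0 < δ) (hδ1 : δ ≤ 1) :
    ∫ z in {z | δ < ‖z‖}, u (x + z) ∂S.levy ≤ -g x := by
  have h1 := h x 0 0 δ hδ hδ1 fun z _ => by simpa [hx] using h0 (x + z)
  simp only [hx, zero_sub, zero_mul, add_zero, integral_neg] at h1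
  linarith

/-- Comparison with a downward paraboloid. -/
lemma ParabolicSuper.le_of_barrier (hd : 2 ≤ d) {g u : Rd d → ℝ} (h : S.ParabolicSuper g u)
    (hu : Continuous u) (h0 : ∀ x, 0 ≤ u x) {M : ℝ} (hM : ∀ x, |u x| ≤ M) {y : Rd d} {δ a κ κ' : ℝ}
    (hδ : 0 < δ) (hδ1 : δ ≤ 1) (ha : 0 < a)
    (hg : ∀ x ∈ closedBall y δ, u x < a → -κ' < g x)
    (hκ : ∀ x ∈ closedBall y δ, κ ≤ ∫ z in {z | δ < ‖z‖}, u (x + z) ∂S.levy)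
    (hle : a * S.trunc δ ≤ κ - κ') : a ≤ u y := by
  by_contra! hlt
  obtain ⟨x, hx, hmin⟩ := (isCompact_closedBall y δ).exists_isMinOn
    ⟨y, mem_closedBall_self hδ.le⟩ (f := fun x => u x + a / δ ^ 2 * ‖x - y‖ ^ 2) (by fun_prop)
  rw [isMinOn_iff] at hmin
  have hA : 0 < a / δ ^ 2 := by positivity
  have hy := hmin y (mem_closedBall_self hδ.le)
  simp only [sub_self, norm_zero, ne_eq, OfNat.ofNat_ne_zero, not_false_eq_true, zero_pow,
    mul_zero, add_zero] at hy
  have hxa : u x < a := lt_of_le_of_lt (le_trans (le_add_of_nonneg_right (by positivity)) hy) hlt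
  have hglob : ∀ x', u x + a / δ ^ 2 * ‖x - y‖ ^ 2 ≤ u x' + a / δ ^ 2 * ‖x' - y‖ ^ 2 := by
    intro x'
    by_cases hx' : x' ∈ closedBall y δ
    · exact hmin x' hx'
    · rw [mem_closedBall, dist_eq_norm, not_le] at hx'
      have h1 : a / δ ^ 2 * δ ^ 2 ≤ a / δ ^ 2 * ‖x' - y‖ ^ 2 := by gcongr
      rw [div_mul_cancel₀ _ (by positivity)] at h1
      linarith [h0 x']
  have hT := h x (-((2 * (a / δ ^ 2)) • (x - y))) (a / δ ^ 2) δ hδ hδ1 fun z _ => by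
    have h1 := hglob (x + z)
    rw [add_sub_right_comm, norm_add_sq_real] at h1
    rw [inner_neg_left, real_inner_smul_left]
    linarith
  have hlev : S.levy {z | δ < ‖z‖} < ∞ := S.levy_norm_gt_lt_top hd hδ
  have i1 : IntegrableOn (fun z => u (x + z)) {z | δ < ‖z‖} S.levy :=
    S.integrableOn_norm_gt hd hδ (by fun_prop) fun z _ => hM _
  have h1 : ∫ z in {z | δ < ‖z‖}, (u x - u (x + z)) ∂S.levy =
      u x * (S.levy {z | δ < ‖z‖}).toReal - ∫ z in {z | δ < ‖z‖}, u (x + z) ∂S.levy := by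
    have e := integral_sub (integrableOn_const (C := u x) hlev.ne) i1
    rw [e, setIntegral_const, smul_eq_mul, mul_comm, Measure.real]
  have h2 : u x * (S.levy {z | δ < ‖z‖}).toReal ≤ a * (S.levy {z | δ < ‖z‖}).toReal := by gcongr
  have h3 := hκ x hx
  have h4 := hg x hx hxa
  rw [trunc_eq hd hδ, mul_add, ← mul_assoc, mul_one_div] at hle
  linarith

lemma exists_integral_lower_bound (hd : 2 ≤ d) {u : Rd d → ℝ} (hu : Continuous u)
    (h0 : ∀ x, 0 ≤ u x) {M : ℝ} (hM : ∀ x, |u x| ≤ M) {x₀ y : Rd d} {r : ℝ} (hr : 0 < r)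
    (hxy : ‖y - x₀‖ = r) (hpos : ∀ x ∈ closedBall y (r / 2), 0 < u x) :
    ∃ κ > 0, ∀ x, ‖x - x₀‖ ≤ r / 4 → ∀ δ, 0 < δ → δ ≤ r / 8 →
      κ ≤ ∫ z in {z | δ < ‖z‖}, u (x + z) ∂S.levy := by
  obtain ⟨x₁, hx₁, hmin⟩ := (isCompact_closedBall y (r / 2)).exists_isMinOn
    ⟨y, mem_closedBall_self (by positivity)⟩ hu.continuousOn
  rw [isMinOn_iff] at hmin
  refine ⟨u x₁ * (S.j (2 * r) * ((r / 2) ^ d * unitVol d)),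
    mul_pos (hpos x₁ hx₁) (mul_pos (S.j_pos hd (by positivity))
      (mul_pos (by positivity) unitVol_pos)), fun x hx δ hδ hδr => ?_⟩
  have h1 := integral_norm_gt_add_le (S := S) hd (v := fun z => u (x + z)) (by fun_prop)
    (fun z => h0 _) (fun z => hM _) (R := 2 * r) (ρ := r / 2) (m := u x₁) (c := y - x) hδ
    (by linarith) (by positivity) (h0 _) fun z hz => by
      rw [mem_closedBall, dist_eq_norm] at hz
      have e : y - x = (y - x₀) - (x - x₀) := by abel
      have h2 : ‖y - x‖ ≤ r + r / 4 := by
        rw [e, ← hxy]; exact (norm_sub_le _ _).trans (by linarith)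
      have h3 : r - r / 4 ≤ ‖y - x‖ := by
        rw [e]; have := norm_sub_norm_le (y - x₀) (x - x₀); linarith
      have h4 := norm_sub_norm_le (y - x) z
      rw [norm_sub_rev (y - x) z] at h4
      have h5 := norm_sub_norm_le z (y - x)
      refine ⟨by linarith, by linarith, hmin _ ?_⟩
      rw [mem_closedBall, dist_eq_norm, show x + z - y = z - (y - x) by abel]
      exact hz
  have h2 : 0 ≤ ∫ z in {z | 2 * r < ‖z‖}, u (x + z) ∂S.levy := integral_nonneg fun z => h0 _
  linarith

/-- A bound on dyadic increments forces `I` to be unbounded near `0`. -/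
lemma false_of_dyadic {I : ℝ → ℝ} {s C c : ℝ} (hs : 0 < s) (hc : 0 < c)
    (hI0 : ∀ t, 0 < t → t ≤ s → 0 ≤ I t) (hIC : ∀ t, 0 < t → t ≤ s → I t ≤ C)
    (hstep : ∀ t, 0 < t → t ≤ s → I t + c ≤ I (t / 2)) : False := by
  have key : ∀ k : ℕ, k * c ≤ I (s / 2 ^ k) := by
    intro k
    induction k with
    | zero => simpa using hI0 s hs le_rfl
    | succ k ih =>
      have h1 := hstep (s / 2 ^ k) (by positivity)
        (div_le_self hs.le (one_le_pow₀ one_le_two))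
      rw [div_div, ← pow_succ] at h1
      push_cast
      linarith
  obtain ⟨k, hk⟩ := exists_nat_gt (C / c)
  rw [div_lt_iff₀ hc] at hk
  have := hIC (s / 2 ^ k) (by positivity) (div_le_self hs.le (one_le_pow₀ one_le_two))
  linarith [key k]

/-- Near a boundary zero with an interior ball, a supersolution dominates `1 / trunc`. -/
lemma ParabolicSuper.integral_dyadic_step (hd : 2 ≤ d) {f : ℝ → ℝ} {u : Rd d → ℝ}
    (h : S.ParabolicSuper (fun x => f (u x)) u) (hu : Continuous u) (h0 : ∀ x, 0 ≤ u x) {M : ℝ}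
    (hM : ∀ x, |u x| ≤ M) {x₀ e : Rd d} {r κ s s₁ c : ℝ} (he : ‖e‖ = 1)
    (hpos : ∀ x ∈ ball (x₀ + r • e) r, 0 < u x) (hκ0 : 0 < κ)
    (hκ : ∀ x, ‖x - x₀‖ ≤ r / 4 → ∀ δ, 0 < δ → δ ≤ r / 8 →
      κ ≤ ∫ z in {z | δ < ‖z‖}, u (x + z) ∂S.levy)
    (hs₁ : ∀ t, 0 < t → t ≤ s₁ → -(κ / 2) ≤ f t) (hs : 0 < s) (hsr : s ≤ r / 8) (hs1 : s ≤ 1)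
    (hT : 0 < S.trunc (s / 2)) (hTs : κ / (8 * S.trunc (s / 2)) ≤ s₁)
    (hc : c * S.trunc s ≤ S.j s * s ^ d) (hc0 : 0 < c) :
    ∫ z in {z | s < ‖z‖}, u (x₀ + z) ∂S.levy + κ * c * unitVol d / (32 * 8 ^ d) ≤
      ∫ z in {z | s / 2 < ‖z‖}, u (x₀ + z) ∂S.levy := by
  have hUV := unitVol_pos (d := d)
  have hse : ‖(3 / 4 * s) • e‖ = 3 / 4 * s := by
    rw [norm_smul, he, Real.norm_of_nonneg (by positivity), mul_one]
  have h1 := integral_norm_gt_add_le (S := S) hd (v := fun z => u (x₀ + z)) (by fun_prop)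
    (fun z => h0 _) (fun z => hM _) (R := s) (ρ := s / 8) (m := κ / (8 * S.trunc (s / 2)))
    (c := (3 / 4 * s) • e) (half_pos hs) (by linarith) (by positivity) (by positivity) fun z hz => by
      rw [mem_closedBall, dist_eq_norm] at hz
      have h4 := norm_sub_norm_le ((3 / 4 * s) • e) z
      rw [norm_sub_rev _ z] at h4
      have h5 := norm_sub_norm_le z ((3 / 4 * s) • e)
      refine ⟨by linarith, by linarith, ?_⟩
      refine h.le_of_barrier hd hu h0 hM (κ := κ) (κ' := 3 * κ / 4) (δ := s / 2) (by positivity)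
        (by linarith) (by positivity) ?_ ?_ ?_
      · intro x hx hxa
        rw [mem_closedBall, dist_eq_norm] at hx
        have hxp : 0 < u x := hpos x <| by
          rw [mem_ball, dist_eq_norm,
            show x - (x₀ + r • e) = (x - (x₀ + z)) + (z - (3 / 4 * s) • e) - (r - 3 / 4 * s) • e by
              module]
          refine (norm_sub_le _ _).trans_lt ?_
          rw [norm_smul, he, Real.norm_of_nonneg (by linarith), mul_one]
          have := norm_add_le (x - (x₀ + z)) (z - (3 / 4 * s) • e)
          linarith
        have := hs₁ _ hxp (hxa.le.trans hTs)
        show -(3 * κ / 4) < f (u x)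
        linarith
      · intro x hx
        rw [mem_closedBall, dist_eq_norm] at hx
        refine hκ x ?_ _ (by positivity) (by linarith)
        rw [show x - x₀ = (x - (x₀ + z)) + z by abel]
        refine (norm_add_le _ _).trans ?_
        linarith
      · rw [div_mul_eq_mul_div, div_le_iff₀ (by positivity)]
        nlinarith
  refine le_trans ?_ h1
  gcongr
  have h2 : S.trunc (s / 2) ≤ 4 * S.trunc s := by
    have := S.trunc_le hd (half_pos hs) one_le_two
    rw [div_mul_cancel₀ _ two_ne_zero] at this
    linarith
  rw [div_pow, div_mul_eq_mul_div, div_mul_eq_mul_div,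
    div_le_div_iff₀ (by positivity) (by positivity), mul_assoc κ (S.j s * _) _]
  have h3 : S.j s * (s ^ d * unitVol d / 8 ^ d) * (32 * 8 ^ d) =
      32 * unitVol d * (S.j s * s ^ d) := by field_simp
  rw [h3]
  have h4 : c * S.trunc (s / 2) ≤ 4 * (S.j s * s ^ d) := by nlinarith
  calc κ * c * unitVol d * (8 * S.trunc (s / 2))
      = 8 * κ * unitVol d * (c * S.trunc (s / 2)) := by ring
    _ ≤ 8 * κ * unitVol d * (4 * (S.j s * s ^ d)) := by gcongr
    _ = _ := by ring

theorem ParabolicSuper.pos (hd : 2 ≤ d) {f : ℝ → ℝ} {u : Rd d → ℝ}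
    (hsup : S.ParabolicSuper (fun x => f (u x)) u)
    (hsub : S.ParabolicSuper (fun x => -f (u x)) (fun x => -u x)) (hu : Continuous u)
    (h0 : ∀ x, 0 ≤ u x) (hdecay : Tendsto u (cocompact (Rd d)) (𝓝 0)) {t₀ : ℝ} (ht₀ : 0 < t₀)
    (hmono : AntitoneOn f (Ioc 0 t₀)) (hne : ∃ y, u y ≠ 0) (x : Rd d) : 0 < u x := by
  obtain ⟨y, hy⟩ := hne
  refine lt_of_le_of_ne (h0 x) fun hx => ?_
  obtain ⟨zM, hzM⟩ := exists_forall_le_max hu h0 hdecay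
  have hM : ∀ x, |u x| ≤ u zM := fun x => by rw [abs_of_nonneg (h0 x)]; exact hzM x
  obtain ⟨x₀, hx₀, hdist⟩ := (isClosed_eq hu continuous_const :
    IsClosed {x | u x = 0}).exists_infDist_eq_dist ⟨x, hx.symm⟩ y
  replace hx₀ : u x₀ = 0 := hx₀
  have hxy : 0 < ‖y - x₀‖ := by
    rw [norm_pos_iff, sub_ne_zero]; rintro rfl; exact hy hx₀
  obtain ⟨r, hr⟩ : ∃ r, r = ‖y - x₀‖ := ⟨_, rfl⟩
  rw [← hr] at hxy
  have hball : ∀ x ∈ ball y r, 0 < u x := fun x hx => by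
    refine lt_of_le_of_ne (h0 x) fun hx' => ?_
    have h1 := infDist_le_dist_of_mem (x := y) (show x ∈ {x | u x = 0} from hx'.symm)
    rw [hdist, dist_eq_norm y x₀, ← hr] at h1
    rw [mem_ball, dist_comm] at hx
    linarith
  obtain ⟨κ, hκ0, hκ⟩ := exists_integral_lower_bound (S := S) hd hu h0 hM hxy hr.symm
    fun x hx => hball x (closedBall_subset_ball (by linarith) hx)
  have hzero : ∀ t, 0 < t → t ≤ 1 → ∫ z in {z | t < ‖z‖}, u (x₀ + z) ∂S.levy ≤ -f 0 := by
    intro t ht ht1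
    simpa only [hx₀] using hsup.integral_le_of_eq_zero h0 hx₀ ht ht1
  have hf0 : κ ≤ -f 0 := (hκ x₀ (by simp; positivity) (min 1 (r / 8)) (by positivity)
    (min_le_right _ _)).trans (hzero _ (by positivity) (min_le_left _ _))
  obtain ⟨w, hwt, hw⟩ := exists_far hd hu h0 hdecay hsub (half_pos hκ0) ht₀
  have hw0 : 0 < u w := by
    refine lt_of_le_of_ne (h0 w) fun h => ?_
    rw [← h] at hw
    linarith
  have hs₁ : ∀ t, 0 < t → t ≤ u w → -(κ / 2) ≤ f t := fun t ht htw =>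
    hw.trans (hmono ⟨ht, htw.trans hwt⟩ ⟨hw0, hwt⟩ htw)
  obtain ⟨s₀, c, hs₀, hc, hj⟩ := S.exists_le_j hd
  have hev := (S.tendsto_trunc hd).eventually_ge_atTop (κ / (8 * u w))
  rw [eventually_nhdsWithin_iff, Metric.eventually_nhds_iff] at hev
  obtain ⟨η, hη, hev⟩ := hev
  obtain ⟨s, hs, hss₀, hsη, hsr, hs1⟩ : ∃ s, 0 < s ∧ s ≤ s₀ ∧ s ≤ η ∧ s ≤ r / 8 ∧ s ≤ 1 :=
    ⟨min (min s₀ η) (min (r / 8) 1), by positivity, by simp, by simp, by simp, by simp⟩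
  have hUV := unitVol_pos (d := d)
  refine false_of_dyadic (I := fun t => ∫ z in {z | t < ‖z‖}, u (x₀ + z) ∂S.levy) hs
    (c := κ * c * unitVol d / (32 * 8 ^ d)) (by positivity)
    (fun t _ _ => integral_nonneg fun z => h0 _)
    (fun t ht hts => hzero t ht (hts.trans hs1)) fun t ht hts => ?_
  have hT : κ / (8 * u w) ≤ S.trunc (t / 2) := hev (by
    rw [Real.dist_eq, sub_zero, abs_of_pos (half_pos ht)]; linarith) (half_pos ht)
  have hT0 : 0 < S.trunc (t / 2) := lt_of_lt_of_le (by positivity) hT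
  refine hsup.integral_dyadic_step hd hu h0 hM (e := r⁻¹ • (y - x₀)) (r := r) ?_ ?_ hκ0 hκ hs₁ ht
    (hts.trans hsr) (hts.trans hs1) hT0 ?_ (hj t ht (hts.trans hss₀)) hc
  · rw [norm_smul, norm_inv, Real.norm_of_nonneg hxy.le, ← hr, inv_mul_cancel₀ hxy.ne']
  · rw [smul_inv_smul₀ hxy.ne', add_sub_cancel]
    exact hball
  · rw [div_le_iff₀ (by positivity)] at hT ⊢
    linarith

end PsiSetting

section Reflection

variable {d : ℕ}

lemma reflAt_eq_reflection {e : Rd d} (he : ‖e‖ = 1) (lam : ℝ) (x : Rd d) :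
    reflAt e lam x = (ℝ ∙ e)ᗮ.reflection x + (2 * lam) • e := by
  rw [Submodule.reflection_orthogonal_apply, Submodule.reflection_singleton_apply, he, reflAt,
    real_inner_comm]
  simp only [RCLike.ofReal_real_eq_id, id, one_pow, div_one]
  module

lemma inner_reflAt {e : Rd d} (he : ‖e‖ = 1) (lam : ℝ) (x : Rd d) :
    ⟪reflAt e lam x, e⟫ = 2 * lam - ⟪x, e⟫ := by
  rw [reflAt, inner_sub_left, real_inner_smul_left, real_inner_self_eq_norm_sq, he]
  ring

lemma reflAt_reflAt {e : Rd d} (he : ‖e‖ = 1) (lam : ℝ) (x : Rd d) :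
    reflAt e lam (reflAt e lam x) = x := by
  conv_lhs => rw [reflAt, inner_reflAt he]
  rw [reflAt]
  module

@[fun_prop]
lemma continuous_reflAt (e : Rd d) (lam : ℝ) : Continuous (reflAt e lam) := by
  unfold reflAt
  fun_prop

lemma reflAt_of_inner_eq {e : Rd d} {lam : ℝ} {x : Rd d} (hx : ⟪x, e⟫ = lam) :
    reflAt e lam x = x := by
  rw [reflAt, hx, sub_self, zero_smul, sub_zero]

lemma reflAt_add (e : Rd d) (lam : ℝ) (x z : Rd d) :
    reflAt e lam (x + z) = x + reflAt e (lam - ⟪x, e⟫) z := by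
  rw [reflAt, reflAt, inner_add_left]
  module

lemma norm_reflAt_neg_sq {e : Rd d} (he : ‖e‖ = 1) (h : ℝ) (z : Rd d) :
    ‖reflAt e (-h) z‖ ^ 2 = ‖z‖ ^ 2 + 4 * h * (⟪z, e⟫ + h) := by
  rw [reflAt, norm_sub_sq_real, real_inner_smul_right, norm_smul, he, mul_one, Real.norm_eq_abs,
    sq_abs]
  ring

lemma measurePreserving_reflAt {e : Rd d} (he : ‖e‖ = 1) (lam : ℝ) :
    MeasurePreserving (reflAt e lam) := by
  have h := (measurePreserving_add_right volume ((2 * lam) • e)).comp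
    ((ℝ ∙ e)ᗮ.reflection.measurePreserving)
  have e1 : reflAt e lam = (· + (2 * lam) • e) ∘ (ℝ ∙ e)ᗮ.reflection :=
    funext fun x => reflAt_eq_reflection he lam x
  rwa [e1]

namespace PsiSetting

variable {S : PsiSetting d}

lemma levy_preimage_reflAt {e : Rd d} (he : ‖e‖ = 1) (h : ℝ) {s : Set (Rd d)}
    (hs : MeasurableSet s) :
    S.levy (reflAt e (-h) ⁻¹' s) = ∫⁻ z in s, ENNReal.ofReal (S.j ‖reflAt e (-h) z‖) := by
  have hT := measurePreserving_reflAt he (-h)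
  rw [S.levy_eq _ (hT.measurable hs), ← lintegral_indicator (hT.measurable hs),
    ← hT.lintegral_comp (S.measurable_j_norm.indicator (hT.measurable hs)),
    ← lintegral_indicator hs]
  refine lintegral_congr fun z => ?_
  by_cases hz : z ∈ s
  · rw [indicator_of_mem hz, indicator_of_mem (by rwa [mem_preimage, reflAt_reflAt he])]
  · rw [indicator_of_notMem hz, indicator_of_notMem (by rwa [mem_preimage, reflAt_reflAt he])]

lemma j_norm_reflAt_lt (hd : 2 ≤ d) {e : Rd d} (he : ‖e‖ = 1) {h : ℝ} (hh : 0 < h) {z : Rd d}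
    (hz : z ≠ 0) (hzh : -h < ⟪z, e⟫) : S.j ‖reflAt e (-h) z‖ < S.j ‖z‖ := by
  refine S.j_lt hd (norm_pos_iff.2 hz) (lt_of_pow_lt_pow_left₀ 2 (norm_nonneg _) ?_)
  rw [norm_reflAt_neg_sq he]
  have : 0 < 4 * h * (⟪z, e⟫ + h) := by
    have : 0 < ⟪z, e⟫ + h := by linarith
    positivity
  linarith

lemma levy_preimage_reflAt_le (hd : 2 ≤ d) {e : Rd d} (he : ‖e‖ = 1) {h : ℝ} (hh : 0 < h)
    {s : Set (Rd d)} (hs : MeasurableSet s) (hs' : ∀ z ∈ s, z ≠ 0 ∧ -h < ⟪z, e⟫) :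
    S.levy (reflAt e (-h) ⁻¹' s) ≤ S.levy s := by
  rw [levy_preimage_reflAt he h hs, S.levy_eq _ hs]
  exact setLIntegral_mono' hs fun z hz =>
    ENNReal.ofReal_le_ofReal (j_norm_reflAt_lt hd he hh (hs' z hz).1 (hs' z hz).2).le

lemma levy_preimage_reflAt_lt (hd : 2 ≤ d) {e : Rd d} (he : ‖e‖ = 1) {h : ℝ} (hh : 0 < h)
    {s : Set (Rd d)} (hs : MeasurableSet s) (hs' : ∀ z ∈ s, z ≠ 0 ∧ -h < ⟪z, e⟫)
    (hvol : volume s ≠ 0) (hfin : S.levy s ≠ ∞) :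
    S.levy (reflAt e (-h) ⁻¹' s) < S.levy s := by
  have h1 := (levy_preimage_reflAt_le (S := S) hd he hh hs hs').trans_lt hfin.lt_top
  rw [levy_preimage_reflAt he h hs] at h1 ⊢
  rw [S.levy_eq _ hs]
  refine setLIntegral_strict_mono hs hvol S.measurable_j_norm h1.ne
    (Eventually.of_forall fun z hz => ?_)
  rw [ENNReal.ofReal_lt_ofReal_iff (S.j_pos hd (norm_pos_iff.2 (hs' z hz).1))]
  exact j_norm_reflAt_lt hd he hh (hs' z hz).1 (hs' z hz).2

lemma preimage_reflAt_closedBall_subset {e : Rd d} (he : ‖e‖ = 1) {h δ : ℝ}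
    (hδ : δ < h) : reflAt e (-h) ⁻¹' closedBall 0 δ ⊆ {z : Rd d | h < ‖z‖} := by
  intro z hz
  rw [mem_preimage, mem_closedBall_zero_iff] at hz
  have h1 : ⟪reflAt e (-h) z, e⟫ ≤ δ := by
    have := real_inner_le_norm (reflAt e (-h) z) e
    rw [he, mul_one] at this
    linarith
  have h2 : -‖z‖ ≤ ⟪z, e⟫ := by
    have := abs_le.1 (abs_real_inner_le_norm z e)
    rw [he, mul_one] at this
    exact this.1
  have h3 : -δ ≤ ⟪reflAt e (-h) z, e⟫ := by
    have := abs_le.1 (abs_real_inner_le_norm (reflAt e (-h) z) e)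
    rw [he, mul_one] at this
    linarith
  rw [inner_reflAt he] at h1 h3
  show h < ‖z‖
  linarith

lemma le_integral_of_antisymm (hd : 2 ≤ d) {e : Rd d} (he : ‖e‖ = 1) {h δ ε m M C : ℝ}
    (hδ : 0 < δ) (hδh : δ < h) {D : Rd d → ℝ} (hD : Measurable D)
    (hC : ∀ z, |D z| ≤ C) (hDT : ∀ z, D (reflAt e (-h) z) = 2 * M - D z)
    (hD0 : ∀ z, -h ≤ ⟪z, e⟫ → 0 ≤ D z) (hDε : ∀ z ∈ closedBall 0 δ, D z ≤ ε) (hε : 0 ≤ ε)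
    {K : Set (Rd d)} (hK : MeasurableSet K) (hKs : ∀ z ∈ K, δ < ‖z‖ ∧ -h < ⟪z, e⟫)
    (hDm : ∀ z ∈ K, m ≤ D z) :
    m * ((S.levy K).toReal - (S.levy (reflAt e (-h) ⁻¹' K)).toReal) +
        2 * M * (S.levy {z | ⟪z, e⟫ < -h}).toReal - ε * (S.levy {z | h < ‖z‖}).toReal ≤
      ∫ z in {z | δ < ‖z‖}, D z ∂S.levy := by
  have hh := hδ.trans hδh
  have hTm : Measurable (reflAt e (-h)) := (continuous_reflAt e (-h)).measurable
  have mP : MeasurableSet {z : Rd d | -h < ⟪z, e⟫} := by measurability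
  have mN : MeasurableSet {z : Rd d | ⟪z, e⟫ < -h} := by measurability
  have mc : MeasurableSet {z : Rd d | -h ≤ ⟪z, e⟫} := by measurability
  have habs : ∀ z : Rd d, |⟪z, e⟫| ≤ ‖z‖ := fun z => by
    simpa [he] using abs_real_inner_le_norm z e
  set G := {z : Rd d | -h < ⟪z, e⟫} ∩ {z | δ < ‖z‖} with hG
  have mG : MeasurableSet G := mP.inter (measurableSet_norm_gt δ)
  set ν' := S.levy.map (reflAt e (-h)) with hν'
  have iδ : ∀ g : Rd d → ℝ, Measurable g → (∃ C, ∀ z, |g z| ≤ C) →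
      IntegrableOn g {z | δ < ‖z‖} S.levy := fun g hg ⟨C, hgC⟩ =>
    S.integrableOn_norm_gt hd hδ hg fun z _ => hgC z
  have hPfin : ν' {z : Rd d | -h < ⟪z, e⟫} < ∞ := by
    rw [hν', Measure.map_apply hTm mP]
    refine (measure_mono fun z hz => ?_).trans_lt (S.levy_norm_gt_lt_top hd hδ)
    rw [mem_preimage, mem_ofPred_eq, inner_reflAt he] at hz
    have := (abs_le.1 (habs z)).1
    show δ < ‖z‖
    linarith
  have iP : ∀ g : Rd d → ℝ, Measurable g → (∃ C, ∀ z, |g z| ≤ C) →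
      IntegrableOn g {z : Rd d | -h < ⟪z, e⟫} ν' := fun g hg ⟨C, hgC⟩ =>
    IntegrableOn.of_bound hPfin hg.aestronglyMeasurable C
      (Eventually.of_forall fun z => hgC z)
  -- split along the hyperplane
  have hNδ : {z : Rd d | ⟪z, e⟫ < -h} ⊆ {z | δ < ‖z‖} := fun z (hz : ⟪z, e⟫ < -h) => by
    have := (abs_le.1 (habs z)).1
    show δ < ‖z‖
    linarith
  have e1 : ∫ z in {z | δ < ‖z‖}, D z ∂S.levy =
      ∫ z in {z | -h ≤ ⟪z, e⟫} ∩ {z | δ < ‖z‖}, D z ∂S.levy +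
        ∫ z in {z | ⟪z, e⟫ < -h}, D z ∂S.levy := by
    rw [← setIntegral_union _ mN ((iδ D hD ⟨C, hC⟩).mono_set inter_subset_right)
      ((iδ D hD ⟨C, hC⟩).mono_set hNδ)]
    · congr 2
      ext z
      simp only [mem_union, mem_inter_iff, mem_ofPred_eq]
      constructor
      · intro hz
        rcases le_or_gt (-h) ⟪z, e⟫ with h1 | h1
        · exact Or.inl ⟨h1, hz⟩
        · exact Or.inr h1
      · rintro (h1 | h1)
        · exact h1.2
        · exact hNδ h1
    · rw [Set.disjoint_left]
      exact fun z hz (hz' : ⟪z, e⟫ < -h) => absurd hz.1 (not_le.2 hz')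
  have e2 : ∫ z in G, D z ∂S.levy ≤ ∫ z in {z | -h ≤ ⟪z, e⟫} ∩ {z | δ < ‖z‖}, D z ∂S.levy := by
    refine setIntegral_mono_set ((iδ D hD ⟨C, hC⟩).mono_set inter_subset_right) ?_ ?_
    · exact (ae_restrict_mem (mc.inter (measurableSet_norm_gt δ))).mono fun z hz => hD0 z hz.1
    · exact (inter_subset_inter_left _ fun z (hz : -h < ⟪z, e⟫) => hz.le).eventuallyLE
  -- reflect the far half-space
  have e3 : ∫ z in {z | ⟪z, e⟫ < -h}, D z ∂S.levy =
      2 * M * (S.levy {z | ⟪z, e⟫ < -h}).toReal - ∫ z in {z | -h < ⟪z, e⟫}, D z ∂ν' := by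
    have hpre : reflAt e (-h) ⁻¹' {z | -h < ⟪z, e⟫} = {z | ⟪z, e⟫ < -h} := by
      ext z
      simp only [mem_preimage, mem_ofPred_eq, inner_reflAt he]
      constructor <;> intro <;> linarith
    have h1 : ∫ z in {z | -h < ⟪z, e⟫}, D z ∂ν' = ∫ z in {z | ⟪z, e⟫ < -h}, (2 * M - D z) ∂S.levy := by
      rw [hν', setIntegral_map mP hD.aestronglyMeasurable hTm.aemeasurable, hpre]
      simp only [hDT]
    have h2 := integral_sub (integrableOn_const (C := 2 * M)
      ((measure_mono hNδ).trans_lt (S.levy_norm_gt_lt_top hd hδ)).ne)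
      ((iδ D hD ⟨C, hC⟩).mono_set hNδ)
    rw [h1, h2, setIntegral_const, smul_eq_mul, Measure.real]
    ring
  -- the small ball
  have hbP : closedBall 0 δ ⊆ {z : Rd d | -h < ⟪z, e⟫} := fun z hz => by
    rw [mem_closedBall_zero_iff] at hz
    have := (abs_le.1 (habs z)).1
    show -h < ⟪z, e⟫
    linarith
  have e4 : ∫ z in {z | -h < ⟪z, e⟫}, D z ∂ν' =
      ∫ z in G, D z ∂ν' + ∫ z in closedBall 0 δ, D z ∂ν' := by
    rw [← setIntegral_union _ measurableSet_closedBall ((iP D hD ⟨C, hC⟩).mono_set inter_subset_left)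
      ((iP D hD ⟨C, hC⟩).mono_set hbP)]
    · congr 2
      ext z
      simp only [mem_union, mem_inter_iff, mem_ofPred_eq, mem_closedBall_zero_iff]
      constructor
      · intro hz
        rcases le_or_gt ‖z‖ δ with h1 | h1
        · exact Or.inr h1
        · exact Or.inl ⟨hz, h1⟩
      · rintro (h1 | h1)
        · exact h1.1
        · exact hbP (mem_closedBall_zero_iff.2 h1)
    · rw [Set.disjoint_left]
      exact fun z hz hz' => absurd hz.2 (not_lt.2 (mem_closedBall_zero_iff.1 hz'))
  have e5 : ∫ z in closedBall 0 δ, D z ∂ν' ≤ ε * (S.levy {z | h < ‖z‖}).toReal := by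
    have hfin : S.levy {z : Rd d | h < ‖z‖} < ∞ := S.levy_norm_gt_lt_top hd hh
    have hb : ν' (closedBall 0 δ) ≤ S.levy {z | h < ‖z‖} := by
      rw [hν', Measure.map_apply hTm measurableSet_closedBall]
      exact measure_mono (preimage_reflAt_closedBall_subset he hδh)
    calc ∫ z in closedBall 0 δ, D z ∂ν' ≤ ∫ z in closedBall 0 δ, ε ∂ν' :=
          setIntegral_mono_on ((iP D hD ⟨C, hC⟩).mono_set hbP)
            (integrableOn_const ((measure_mono hbP).trans_lt hPfin).ne) measurableSet_closedBall hDε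
      _ = ε * (ν' (closedBall 0 δ)).toReal := by
          rw [setIntegral_const, smul_eq_mul, mul_comm, Measure.real]
      _ ≤ _ := mul_le_mul_of_nonneg_left (ENNReal.toReal_mono hfin.ne hb) hε
  -- compare the two measures on `G`
  have hKG : K ⊆ G := fun z hz => ⟨(hKs z hz).2, (hKs z hz).1⟩
  have hle : ν'.restrict G ≤ S.levy.restrict G := by
    refine Measure.le_iff.2 fun s hs => ?_
    rw [Measure.restrict_apply hs, Measure.restrict_apply hs, hν',
      Measure.map_apply hTm (hs.inter mG)]
    exact levy_preimage_reflAt_le hd he hh (hs.inter mG) fun z hz =>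
      ⟨norm_pos_iff.1 (hδ.trans hz.2.2), hz.2.1⟩
  have iG : IntegrableOn D G S.levy := (iδ D hD ⟨C, hC⟩).mono_set inter_subset_right
  have iG' : IntegrableOn D G ν' := (iP D hD ⟨C, hC⟩).mono_set inter_subset_left
  have hKfin : S.levy K ≠ ∞ :=
    ((measure_mono fun z hz => (hKs z hz).1).trans_lt (S.levy_norm_gt_lt_top hd hδ)).ne
  have hKfin' : ν' K ≠ ∞ := ((measure_mono fun z hz => (hKs z hz).2).trans_lt hPfin).ne
  have iK : IntegrableOn (K.indicator fun _ => m) G S.levy :=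
    ((integrable_indicator_iff hK).2 (integrableOn_const hKfin)).integrableOn
  have iK' : IntegrableOn (K.indicator fun _ => m) G ν' :=
    ((integrable_indicator_iff hK).2 (integrableOn_const hKfin')).integrableOn
  have hind : ∀ μ : Measure (Rd d), ∫ z in G, K.indicator (fun _ => m) z ∂μ = m * (μ K).toReal :=
    fun μ => by
      rw [setIntegral_indicator hK, inter_eq_self_of_subset_right hKG, setIntegral_const,
        smul_eq_mul, mul_comm, Measure.real]
  have e6 : ∫ z in G, (D z - K.indicator (fun _ => m) z) ∂ν' ≤
      ∫ z in G, (D z - K.indicator (fun _ => m) z) ∂S.levy := by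
    refine integral_mono_measure hle ?_ (iG.sub iK)
    refine (ae_restrict_mem mG).mono fun z hz => ?_
    show 0 ≤ D z - K.indicator (fun _ => m) z
    by_cases hzK : z ∈ K
    · rw [indicator_of_mem hzK]; linarith [hDm z hzK]
    · rw [indicator_of_notMem hzK, sub_zero]; exact hD0 z (le_of_lt hz.1)
  rw [integral_sub iG iK, integral_sub iG' iK', hind, hind, hν', Measure.map_apply hTm hK] at e6
  rw [← hν'] at e6
  rw [e1, e3, e4, mul_sub]
  linarith

end PsiSetting

end Reflection

namespace PsiSetting

variable {d : ℕ} {S : PsiSetting d} {f : ℝ → ℝ} {u : Rd d → ℝ}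

/-- A positive continuous decaying solution, in the form used by the moving plane method. -/
structure PosSol (S : PsiSetting d) (f : ℝ → ℝ) (u : Rd d → ℝ) : Prop where
  cont : Continuous u
  pos : ∀ x, 0 < u x
  decay : Tendsto u (cocompact (Rd d)) (𝓝 0)
  super : S.ParabolicSuper (fun x => f (u x)) u
  sub : S.ParabolicSuper (fun x => -f (u x)) (fun x => -u x)
  lip : ∃ L : ℝ≥0, LipschitzOnWith L f (Ioi 0)

namespace PosSol

lemma continuous_comp (h : PosSol S f u) : Continuous fun x => f (u x) := by
  obtain ⟨L, hL⟩ := h.lip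
  exact hL.continuousOn.comp_continuous h.cont h.pos

lemma exists_bound (h : PosSol S f u) : ∃ M, ∀ x, |u x| ≤ M := by
  obtain ⟨z, hz⟩ := exists_forall_le_max h.cont (fun x => (h.pos x).le) h.decay
  exact ⟨u z, fun x => by rw [abs_of_pos (h.pos x)]; exact hz x⟩

/-- The inequality satisfied at a maximum point of `u - u ∘ R` over a half-space. -/
lemma le_sub_of_max (hd : 2 ≤ d) (h : PosSol S f u) {e : Rd d} (he : ‖e‖ = 1) {lam : ℝ} {x : Rd d}
    (hx : lam < ⟪x, e⟫) (hM0 : u (reflAt e lam x) ≤ u x)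
    (hmax : ∀ y, lam < ⟪y, e⟫ → u y - u (reflAt e lam y) ≤ u x - u (reflAt e lam x)) {m η : ℝ}
    (hη : 0 < η) {K : Set (Rd d)} (hK : MeasurableSet K)
    (hKs : ∀ z ∈ K, η < ‖z‖ ∧ -(⟪x, e⟫ - lam) < ⟪z, e⟫)
    (hDm : ∀ z ∈ K, m ≤
      u x - u (reflAt e lam x) - (u (x + z) - u (reflAt e lam (x + z)))) :
    m * ((S.levy K).toReal - (S.levy (reflAt e (-(⟪x, e⟫ - lam)) ⁻¹' K)).toReal) +
        2 * (u x - u (reflAt e lam x)) * (S.levy {z | ⟪z, e⟫ < -(⟪x, e⟫ - lam)}).toReal ≤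
      f (u x) - f (u (reflAt e lam x)) := by
  obtain ⟨C, hC⟩ := h.exists_bound
  have hu := h.cont
  have hfu := h.continuous_comp
  obtain ⟨κ, hκ⟩ : ∃ κ, κ = ⟪x, e⟫ - lam := ⟨_, rfl⟩
  have hκ0 : 0 < κ := by linarith
  rw [← hκ] at hKs ⊢
  have hRc := continuous_reflAt e lam
  have huR : Continuous fun y => u (reflAt e lam y) := by fun_prop
  set D : Rd d → ℝ := fun z => u x - u (reflAt e lam x) - (u (x + z) - u (reflAt e lam (x + z)))
    with hD
  have hDc : Continuous D := by fun_prop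
  have hRx : ∀ z, x + reflAt e (-κ) z = reflAt e lam (x + z) := fun z => by
    rw [reflAt_add, hκ, neg_sub]
  have hsuperR : S.ParabolicSuper (fun y => f (u (reflAt e lam y))) (fun y => u (reflAt e lam y)) := by
    have := h.super.comp_isometry ((ℝ ∙ e)ᗮ.reflection) ((2 * lam) • e)
    simpa only [← reflAt_eq_reflection he] using this
  have hfuR : Continuous fun y => f (u (reflAt e lam y)) := hfu.comp hRc
  have hfar : 0 ≤ (S.levy {z : Rd d | κ < ‖z‖}).toReal := ENNReal.toReal_nonneg
  refine le_of_forall_pos_le_add fun ε hε => ?_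
  set ε' := ε / ((S.levy {z : Rd d | κ < ‖z‖}).toReal + 1) with hε'
  have hε'0 : 0 < ε' := by positivity
  have hD0 : D 0 = 0 := by simp [hD]
  obtain ⟨δ₁, hδ₁, hball⟩ := Metric.continuousAt_iff.1 (hDc.continuousAt (x := 0)) ε' hε'0
  obtain ⟨δ, hδ, hδδ₁, hδκ, hδη, hδ1⟩ : ∃ δ, 0 < δ ∧ δ < δ₁ ∧ 2 * δ < κ ∧ δ ≤ η ∧ δ ≤ 1 := by
    refine ⟨min (min (δ₁ / 2) (κ / 4)) (min η 1), by positivity, ?_, ?_, by simp, by simp⟩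
    · exact ((min_le_left _ _).trans (min_le_left _ _)).trans_lt (by linarith)
    · have : min (min (δ₁ / 2) (κ / 4)) (min η 1) ≤ κ / 4 :=
        (min_le_left _ _).trans (min_le_right _ _)
      linarith
  have h1 := ParabolicSuper.add_le_of_isLocalMin hd h.sub hsuperR hu.neg huR
    (M := C) (fun y => by simpa using hC y) (fun y => hC _) (x₀ := x)
    hfu.neg.continuousAt hfuR.continuousAt hδ hδ1 fun y hy => by
      rw [mem_closedBall, dist_eq_norm] at hy
      have h2 := abs_le.1 (abs_real_inner_le_norm (y - x) e)
      rw [he, mul_one, inner_sub_left] at h2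
      have := hmax y (by linarith [h2.1])
      linarith
  have h2 := le_integral_of_antisymm (S := S) hd he (ε := ε') (h := κ) (D := D) (K := K) (m := m)
    (M := u x - u (reflAt e lam x)) (C := C + C + (C + C)) hδ (by linarith) hDc.measurable
    (fun z => by
      refine (abs_sub _ _).trans (add_le_add ((abs_sub _ _).trans ?_) ((abs_sub _ _).trans ?_)) <;>
        exact add_le_add (hC _) (hC _))
    (fun z => by
      simp only [hD]
      rw [hRx, reflAt_reflAt he]
      ring)
    (fun z hz => by
      simp only [hD]
      rcases hz.lt_or_eq with h3 | h3
      · have := hmax (x + z) (by rw [inner_add_left]; linarith)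
        linarith
      · rw [reflAt_of_inner_eq (x := x + z) (by rw [inner_add_left]; linarith)]
        linarith)
    (fun z hz => by
      have := hball (lt_of_le_of_lt (mem_closedBall.1 hz) hδδ₁)
      rw [hD0, dist_zero_right, Real.norm_eq_abs] at this
      exact (le_abs_self _).trans this.le)
    hε'0.le hK (fun z hz => ⟨hδη.trans_lt (hKs z hz).1, (hKs z hz).2⟩) hDm
  have h3 : ∫ z in {z | δ < ‖z‖}, (-u x + u (reflAt e lam x) -
      (-u (x + z) + u (reflAt e lam (x + z)))) ∂S.levy = -∫ z in {z | δ < ‖z‖}, D z ∂S.levy := by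
    rw [← integral_neg]
    congr 1
    ext z
    simp only [hD]
    ring
  rw [h3] at h1
  have h4 : ε' * (S.levy {z : Rd d | κ < ‖z‖}).toReal ≤ ε := by
    rw [hε', div_mul_eq_mul_div, div_le_iff₀ (by positivity)]
    nlinarith
  linarith

end PosSol

/-- `u` is dominated on the half-space by its reflection. -/
def ReflLE (u : Rd d → ℝ) (e : Rd d) (lam : ℝ) : Prop :=
  ∀ x, lam < ⟪x, e⟫ → u x ≤ u (reflAt e lam x)

/-- Strict version of `ReflLE`. -/
def ReflLT (u : Rd d → ℝ) (e : Rd d) (lam : ℝ) : Prop :=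
  ∀ x, lam < ⟪x, e⟫ → u x < u (reflAt e lam x)

lemma levy_halfSpace_lt_top (hd : 2 ≤ d) {e : Rd d} (he : ‖e‖ = 1) {h : ℝ} (hh : 0 < h) :
    S.levy {z | ⟪z, e⟫ < -h} < ∞ := by
  refine (measure_mono fun z hz => ?_).trans_lt (S.levy_norm_gt_lt_top hd hh)
  have h1 := (abs_le.1 (abs_real_inner_le_norm z e)).1
  rw [he, mul_one] at h1
  replace hz : ⟪z, e⟫ < -h := hz
  show h < ‖z‖
  linarith

lemma levy_halfSpace_pos (hd : 2 ≤ d) {e : Rd d} (he : ‖e‖ = 1) {h : ℝ} (hh : 0 < h) :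
    0 < (S.levy {z | ⟪z, e⟫ < -h}).toReal := by
  refine ENNReal.toReal_pos ?_ (levy_halfSpace_lt_top hd he hh).ne
  have hc : ‖(-(h + 2)) • e‖ = h + 2 := by
    rw [norm_smul, he, mul_one, norm_neg, Real.norm_of_nonneg (by linarith)]
  have hin : ∀ z ∈ ball ((-(h + 2)) • e) 1, ⟪z, e⟫ < -h ∧ ‖z‖ ≤ h + 3 := by
    intro z hz
    rw [mem_ball, dist_eq_norm] at hz
    constructor
    · have h1 := (abs_le.1 (abs_real_inner_le_norm (z - (-(h + 2)) • e) e)).2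
      rw [inner_sub_left, real_inner_smul_left, real_inner_self_eq_norm_sq, he] at h1
      linarith
    · have := norm_sub_norm_le z ((-(h + 2)) • e)
      linarith
  have h1 := S.le_levy hd (R := h + 3) (s := ball ((-(h + 2)) • e) 1) measurableSet_ball
    fun z hz => ⟨by
      rintro rfl
      have := (hin 0 hz).1
      rw [inner_zero_left] at this
      linarith, (hin z hz).2⟩
  have h2 : 0 < ENNReal.ofReal (S.j (h + 3)) * volume (ball ((-(h + 2)) • e) 1) :=
    ENNReal.mul_pos (ENNReal.ofReal_pos.2 (S.j_pos hd (by linarith))).ne'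
      (measure_ball_pos _ _ one_pos).ne'
  exact (h2.trans_le (h1.trans (measure_mono fun z hz => (hin z hz).1))).ne'

namespace PosSol

lemma exists_max_of_not_reflLE (h : PosSol S f u) {e : Rd d} {lam : ℝ} (hn : ¬ReflLE u e lam) :
    ∃ x, lam < ⟪x, e⟫ ∧ u (reflAt e lam x) < u x ∧
      ∀ y, lam < ⟪y, e⟫ → u y - u (reflAt e lam y) ≤ u x - u (reflAt e lam x) := by
  unfold ReflLE at hn
  push Not at hn
  obtain ⟨x₀, hx₀, hlt⟩ := hn
  have hu := h.cont
  have hc : IsClosed {y : Rd d | lam ≤ ⟪y, e⟫} := isClosed_le (by fun_prop) (by fun_prop)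
  obtain ⟨x, hx, hmax⟩ := ContinuousOn.exists_isMaxOn'
    (f := fun y => u y - u (reflAt e lam y)) (by fun_prop : Continuous _).continuousOn hc
    (x₀ := x₀) hx₀.le (by
      refine Filter.Eventually.filter_mono inf_le_left ?_
      refine (h.decay.eventually_le_const (sub_pos.2 hlt)).mono fun y hy => ?_
      linarith [(h.pos (reflAt e lam y)).le])
  rw [isMaxOn_iff] at hmax
  have h1 := hmax x₀ hx₀.le
  refine ⟨x, lt_of_le_of_ne hx fun h2 => ?_, by linarith, fun y hy => hmax y hy.le⟩
  rw [reflAt_of_inner_eq h2.symm] at h1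
  linarith

lemma exists_of_not_reflLE (hd : 2 ≤ d) (h : PosSol S f u) {t₀ : ℝ}
    (hmono : AntitoneOn f (Ioc 0 t₀)) {L : ℝ≥0} (hL : LipschitzOnWith L f (Ioi 0)) {e : Rd d}
    (he : ‖e‖ = 1) {lam : ℝ} (hn : ¬ReflLE u e lam) :
    ∃ x, lam < ⟪x, e⟫ ∧ u (reflAt e lam x) < u x ∧ t₀ < u x ∧
      (S.levy {z | ⟪z, e⟫ < -(⟪x, e⟫ - lam)}).toReal ≤ L := by
  obtain ⟨x, hx, hlt, hmax⟩ := h.exists_max_of_not_reflLE hn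
  have h1 := h.le_sub_of_max hd he hx hlt.le hmax (m := 0) one_pos (K := ∅) MeasurableSet.empty
    (by simp) (by simp)
  have h2 := levy_halfSpace_pos (S := S) hd he (sub_pos.2 hx)
  rw [zero_mul, zero_add] at h1
  have h3 := sub_pos.2 hlt
  refine ⟨x, hx, hlt, ?_, ?_⟩
  · by_contra! hle
    have h4 := hmono ⟨h.pos _, hlt.le.trans hle⟩ ⟨h.pos x, hle⟩ hlt.le
    have : 0 < 2 * (u x - u (reflAt e lam x)) * (S.levy {z | ⟪z, e⟫ < -(⟪x, e⟫ - lam)}).toReal := by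
      positivity
    linarith
  · have h4 := hL.dist_le_mul _ (h.pos x) _ (h.pos (reflAt e lam x))
    rw [Real.dist_eq, Real.dist_eq, abs_of_pos h3] at h4
    have h5 := le_abs_self (f (u x) - f (u (reflAt e lam x)))
    refine le_of_mul_le_mul_right (?_ : _ ≤ (L : ℝ) * (u x - u (reflAt e lam x))) h3
    nlinarith

/-- Strong maximum principle. -/
lemma eq_of_reflLE (hd : 2 ≤ d) (h : PosSol S f u) {e : Rd d} (he : ‖e‖ = 1) {lam : ℝ}
    (hle : ReflLE u e lam) {x : Rd d} (hx : lam < ⟪x, e⟫) (hxe : u x = u (reflAt e lam x)) {y : Rd d}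
    (hy : lam < ⟪y, e⟫) : u y = u (reflAt e lam y) := by
  by_contra hne
  have hlt := lt_of_le_of_ne (hle y hy) hne
  have hyx : 0 < ‖y - x‖ := by
    rw [norm_pos_iff, sub_ne_zero]; rintro rfl; exact hne hxe
  have hu := h.cont
  set m := (u (reflAt e lam y) - u y) / 2 with hm
  have hm0 : 0 < m := by linarith
  have hO : IsOpen {z : Rd d | m < u (reflAt e lam (x + z)) - u (x + z) ∧ ‖y - x‖ / 2 < ‖z‖ ∧
      -(⟪x, e⟫ - lam) < ⟪z, e⟫} := by
    have o1 : IsOpen {z : Rd d | m < u (reflAt e lam (x + z)) - u (x + z)} :=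
      isOpen_lt (by fun_prop) (by fun_prop)
    have o2 : IsOpen {z : Rd d | ‖y - x‖ / 2 < ‖z‖} := isOpen_lt (by fun_prop) (by fun_prop)
    have o3 : IsOpen {z : Rd d | -(⟪x, e⟫ - lam) < ⟪z, e⟫} := isOpen_lt (by fun_prop) (by fun_prop)
    exact o1.inter (o2.inter o3)
  have hyO : y - x ∈ {z : Rd d | m < u (reflAt e lam (x + z)) - u (x + z) ∧ ‖y - x‖ / 2 < ‖z‖ ∧
      -(⟪x, e⟫ - lam) < ⟪z, e⟫} := by
    refine ⟨?_, by linarith, by rw [inner_sub_left]; linarith⟩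
    rw [add_sub_cancel]
    linarith
  obtain ⟨ρ, hρ, hK⟩ := Metric.isOpen_iff.1 hO _ hyO
  have h1 := h.le_sub_of_max hd he hx hxe.symm.le
    (fun y hy => by have := hle y hy; linarith) (m := m) (half_pos hyx) (K := ball (y - x) ρ)
    measurableSet_ball (fun z hz => (hK hz).2) (fun z hz => by have := (hK hz).1; linarith)
  rw [← hxe, sub_self, sub_self, mul_zero, zero_mul, add_zero] at h1
  have hfin : S.levy (ball (y - x) ρ) ≠ ∞ :=
    ((measure_mono fun z hz => (hK hz).2.1).trans_lt
      (S.levy_norm_gt_lt_top hd (half_pos hyx))).ne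
  have h2 := levy_preimage_reflAt_lt (S := S) hd he (sub_pos.2 hx) (s := ball (y - x) ρ)
    measurableSet_ball (fun z hz =>
      ⟨norm_pos_iff.1 ((half_pos hyx).trans (hK hz).2.1), (hK hz).2.2⟩)
    (measure_ball_pos _ _ hρ).ne' hfin
  have h3 := (ENNReal.toReal_lt_toReal h2.ne_top hfin).2 h2
  nlinarith

lemma exists_forall_reflLE (hd : 2 ≤ d) (h : PosSol S f u) {t₀ : ℝ} (ht₀ : 0 < t₀)
    (hmono : AntitoneOn f (Ioc 0 t₀)) {e : Rd d} (he : ‖e‖ = 1) :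
    ∃ lam, ∀ μ, lam ≤ μ → ReflLE u e μ := by
  obtain ⟨L, hL⟩ := h.lip
  have hev := h.decay.eventually_le_const ht₀
  rw [← Metric.cobounded_eq_cocompact, ← comap_norm_atTop, Filter.eventually_comap] at hev
  obtain ⟨N, hN⟩ := eventually_atTop.1 hev
  refine ⟨N, fun μ hμ => ?_⟩
  by_contra hn
  obtain ⟨x, hx, -, hxt, -⟩ := h.exists_of_not_reflLE hd hmono hL he hn
  have h1 := real_inner_le_norm x e
  rw [he, mul_one] at h1
  exact absurd (hN ‖x‖ (by linarith) x rfl) (not_le.2 hxt)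

lemma reflLT_of_reflLE (hd : 2 ≤ d) (h : PosSol S f u) {e : Rd d} (he : ‖e‖ = 1) {lam μ : ℝ}
    (hlt : lam < μ) (hlam : ReflLE u e lam) (hμ : ReflLE u e μ) : ReflLT u e μ := by
  intro x hx
  refine lt_of_le_of_ne (hμ x hx) fun hxe => ?_
  have heq : ∀ y, lam < ⟪y, e⟫ → u y ≤ u (y + (2 * (μ - lam)) • e) := by
    intro y hy
    have h1 : reflAt e lam y = reflAt e μ (y + (2 * (μ - lam)) • e) := by
      rw [reflAt, reflAt, inner_add_left, real_inner_smul_left, real_inner_self_eq_norm_sq, he]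
      module
    rw [h.eq_of_reflLE hd he hμ hx hxe (y := y + (2 * (μ - lam)) • e), ← h1]
    · exact hlam y hy
    · rw [inner_add_left, real_inner_smul_left, real_inner_self_eq_norm_sq, he]
      linarith
  have hiter : ∀ n : ℕ, u x ≤ u (x + (n * (2 * (μ - lam))) • e) := by
    intro n
    induction n with
    | zero => simp
    | succ n ih =>
      refine ih.trans ((heq _ ?_).trans_eq ?_)
      · rw [inner_add_left, real_inner_smul_left, real_inner_self_eq_norm_sq, he]
        have : 0 ≤ n * (2 * (μ - lam)) := mul_nonneg n.cast_nonneg (by linarith)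
        linarith
      · congr 1
        push_cast
        module
  have hev := h.decay.eventually_lt_const (h.pos x)
  rw [← Metric.cobounded_eq_cocompact, ← comap_norm_atTop, Filter.eventually_comap] at hev
  obtain ⟨N, hN⟩ := eventually_atTop.1 hev
  obtain ⟨n, hn⟩ := exists_nat_gt ((N + ‖x‖) / (2 * (μ - lam)))
  rw [div_lt_iff₀ (by linarith)] at hn
  refine absurd (hN ‖x + (n * (2 * (μ - lam))) • e‖ ?_ _ rfl) (not_lt.2 (hiter n))
  have h1 := norm_sub_norm_le ((n * (2 * (μ - lam))) • e) (-x)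
  rw [sub_neg_eq_add, norm_neg, norm_smul, he, mul_one, Real.norm_of_nonneg
    (mul_nonneg n.cast_nonneg (by linarith)), add_comm _ x] at h1
  linarith

/-- If the strict inequality holds at `lam`, the planes can be moved a little further. -/
lemma exists_lt_forall_reflLE (hd : 2 ≤ d) (h : PosSol S f u) {t₀ : ℝ} (ht₀ : 0 < t₀)
    (hmono : AntitoneOn f (Ioc 0 t₀)) {e : Rd d} (he : ‖e‖ = 1) {lam : ℝ}
    (hlt : ReflLT u e lam) : ∃ μ < lam, ∀ ν, μ ≤ ν → ν < lam → ReflLE u e ν := by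
  by_contra! hcon
  obtain ⟨L, hL⟩ := h.lip
  have hu := h.cont
  choose ν hν hνlam hn using fun n : ℕ => hcon (lam - 1 / ((n : ℝ) + 1))
    (sub_lt_self _ Nat.one_div_pos_of_nat)
  choose x hx hxlt hxt hxL using fun n => h.exists_of_not_reflLE hd hmono hL he (hn n)
  obtain ⟨s₀, hs₀, hlevy⟩ := S.exists_levy_halfSpace hd (e := -e) (by rwa [norm_neg]) L
  have hs : ∀ n, s₀ ≤ ⟪x n, e⟫ - ν n := by
    intro n
    by_contra! hlt'
    have h1 := hlevy _ hlt'.le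
    have e1 : {z : Rd d | ⟪x n, e⟫ - ν n < ⟪z, -e⟫} = {z | ⟪z, e⟫ < -(⟪x n, e⟫ - ν n)} := by
      ext z
      simp only [mem_ofPred_eq, inner_neg_right]
      constructor <;> intro <;> linarith
    rw [e1, ENNReal.ofReal_lt_iff_lt_toReal L.coe_nonneg
      (levy_halfSpace_lt_top hd he (sub_pos.2 (hx n))).ne] at h1
    exact absurd (hxL n) (not_le.2 h1)
  have hev := h.decay.eventually_le_const ht₀
  rw [← Metric.cobounded_eq_cocompact, ← comap_norm_atTop, Filter.eventually_comap] at hev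
  obtain ⟨N, hN⟩ := eventually_atTop.1 hev
  have hxN : ∀ n, x n ∈ closedBall (0 : Rd d) N := fun n => by
    rw [mem_closedBall_zero_iff]
    by_contra! h1
    exact absurd (hN _ h1.le (x n) rfl) (not_le.2 (hxt n))
  obtain ⟨y, -, φ, hφ, hlim⟩ := (isCompact_closedBall (0 : Rd d) N).tendsto_subseq hxN
  have hνlim : Tendsto ν atTop (𝓝 lam) := by
    refine tendsto_of_tendsto_of_tendsto_of_le_of_le (g := fun n : ℕ => lam - 1 / ((n : ℝ) + 1))
      ?_ tendsto_const_nhds hν fun n => (hνlam n).le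
    simpa using (tendsto_const_nhds (x := lam)).sub (tendsto_one_div_add_atTop_nhds_zero_nat (𝕜 := ℝ))
  replace hνlim := hνlim.comp hφ.tendsto_atTop
  have hinner : Tendsto (fun n => ⟪x (φ n), e⟫) atTop (𝓝 ⟪y, e⟫) := hlim.inner tendsto_const_nhds
  have h1 : s₀ ≤ ⟪y, e⟫ - lam := ge_of_tendsto' (hinner.sub hνlim) fun n => hs (φ n)
  have h2 : Tendsto (fun n => reflAt e (ν (φ n)) (x (φ n))) atTop (𝓝 (reflAt e lam y)) := by
    unfold reflAt
    exact hlim.sub (((hinner.const_mul 2).sub (hνlim.const_mul 2)).smul_const e)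
  have h3 : u (reflAt e lam y) ≤ u y :=
    le_of_tendsto_of_tendsto' ((hu.tendsto _).comp h2) ((hu.tendsto _).comp hlim)
      fun n => (hxlt (φ n)).le
  exact absurd (hlt y (by linarith)) (not_lt.2 h3)

theorem reflLT_of_max (hd : 2 ≤ d) (h : PosSol S f u) {t₀ : ℝ} (ht₀ : 0 < t₀)
    (hmono : AntitoneOn f (Ioc 0 t₀)) {e : Rd d} (he : ‖e‖ = 1) {z : Rd d} (hz : ∀ y, u y ≤ u z)
    {μ : ℝ} (hμ : ⟪z, e⟫ < μ) : ReflLT u e μ := by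
  set A := {lam : ℝ | ∀ μ, lam ≤ μ → ReflLE u e μ} with hA
  have hstrict : ∀ lam ∈ A, ∀ μ, lam < μ → ReflLT u e μ := fun lam hlam μ hμ =>
    h.reflLT_of_reflLE hd he hμ (hlam lam le_rfl) (hlam μ hμ.le)
  have hmax : ∀ z', (∀ y, u y ≤ u z') → ∀ lam ∈ A, ⟪z', e⟫ ≤ lam := by
    intro z' hz' lam hlam
    by_contra! hlt
    obtain ⟨μ, hμ1, hμ2⟩ := exists_between hlt
    exact absurd (hstrict lam hlam μ hμ1 z' hμ2) (not_lt.2 (hz' _))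
  have hbdd : BddBelow A := ⟨⟪z, e⟫, fun lam hlam => hmax z hz lam hlam⟩
  have hne : A.Nonempty := h.exists_forall_reflLE hd ht₀ hmono he
  have hgt : ∀ μ, sInf A < μ → μ ∈ A := fun μ hμ => by
    obtain ⟨lam, hlam, hlt⟩ := exists_lt_of_csInf_lt hne hμ
    exact fun ν hν => hlam ν (hlt.le.trans hν)
  have hu := h.cont
  have hmem : sInf A ∈ A := by
    intro ν hν
    rcases hν.lt_or_eq with hν | rfl
    · exact hgt ν hν ν le_rfl
    · intro x hx
      have hc : Tendsto (fun lam => u (reflAt e lam x)) (𝓝[>] sInf A) (𝓝 (u (reflAt e (sInf A) x))) := by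
        have : Continuous fun lam => u (reflAt e lam x) := by unfold reflAt; fun_prop
        exact this.continuousAt.tendsto.mono_left nhdsWithin_le_nhds
      refine ge_of_tendsto hc ?_
      filter_upwards [Ioo_mem_nhdsGT hx] with lam hlam
      exact hgt lam hlam.1 lam le_rfl x hlam.2
  rcases (hmax z hz _ hmem).eq_or_lt with heq | hlt
  · exact hstrict _ hmem μ (heq ▸ hμ)
  exfalso
  by_cases hs : ReflLT u e (sInf A)
  · obtain ⟨μ, hμ, hμA⟩ := h.exists_lt_forall_reflLE hd ht₀ hmono he hs
    refine absurd (csInf_le hbdd (show μ ∈ A from fun ν hν => ?_)) (not_le.2 hμ)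
    rcases lt_or_ge ν (sInf A) with h1 | h1
    · exact hμA ν hν h1
    · exact hmem ν h1
  · unfold ReflLT at hs
    push Not at hs
    obtain ⟨x, hx, hle⟩ := hs
    have hzr : sInf A < ⟪reflAt e (sInf A) z, e⟫ := by rw [inner_reflAt he]; linarith
    have h1 := h.eq_of_reflLE hd he (hmem _ le_rfl) hx ((hmem _ le_rfl x hx).antisymm hle) hzr
    rw [reflAt_reflAt he] at h1
    exact absurd (hmax (reflAt e (sInf A) z) (fun y => (hz y).trans_eq h1.symm) _ hmem)
      (not_le.2 hzr)

end PosSol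

/-- Reflection through the bisecting hyperplane exchanges two points. -/
lemma reflAt_bisector {x y : Rd d} (hxy : y ≠ x) :
    reflAt (‖y - x‖⁻¹ • (y - x)) ((‖y‖ ^ 2 - ‖x‖ ^ 2) / (2 * ‖y - x‖)) y = x := by
  have hn : ‖y - x‖ ≠ 0 := norm_ne_zero_iff.2 (sub_ne_zero.2 hxy)
  have h1 : (2 * ⟪y, ‖y - x‖⁻¹ • (y - x)⟫ - 2 * ((‖y‖ ^ 2 - ‖x‖ ^ 2) / (2 * ‖y - x‖))) * ‖y - x‖⁻¹ = 1 := by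
    rw [real_inner_smul_right, inner_sub_right, real_inner_self_eq_norm_sq]
    have h2 := norm_sub_sq_real y x
    field_simp
    linarith
  rw [reflAt, smul_smul, h1, one_smul, sub_sub_cancel]

namespace PosSol

lemma lt_of_norm_lt (hd : 2 ≤ d) (h : PosSol S f u) {t₀ : ℝ} (ht₀ : 0 < t₀)
    (hmono : AntitoneOn f (Ioc 0 t₀)) {z : Rd d} (hz : ∀ y, u y ≤ u z) {x y : Rd d}
    (hxy : ‖x - z‖ < ‖y - z‖) : u y < u x := by
  have hne : y ≠ x := by rintro rfl; exact lt_irrefl _ hxy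
  have hn : 0 < ‖y - x‖ := norm_pos_iff.2 (sub_ne_zero.2 hne)
  have he : ‖‖y - x‖⁻¹ • (y - x)‖ = 1 := by
    rw [norm_smul, norm_inv, norm_norm, inv_mul_cancel₀ hn.ne']
  have hsq : ‖x - z‖ ^ 2 < ‖y - z‖ ^ 2 := by gcongr
  have h1 := norm_sub_sq_real x z
  have h2 := norm_sub_sq_real y z
  have h3 := norm_sub_sq_real y x
  have h4 := h.reflLT_of_max hd ht₀ hmono he hz
    (μ := (‖y‖ ^ 2 - ‖x‖ ^ 2) / (2 * ‖y - x‖)) (by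
      rw [real_inner_smul_right, inner_sub_right, lt_div_iff₀ (by positivity),
        real_inner_comm y z, real_inner_comm x z]
      field_simp
      linarith) y (by
      rw [real_inner_smul_right, inner_sub_right, div_lt_iff₀ (by positivity),
        real_inner_self_eq_norm_sq]
      field_simp
      have := pow_pos hn 2
      linarith)
  rwa [reflAt_bisector hne] at h4

lemma le_of_norm_eq (hd : 2 ≤ d) (h : PosSol S f u) {t₀ : ℝ} (ht₀ : 0 < t₀)
    (hmono : AntitoneOn f (Ioc 0 t₀)) {z : Rd d} (hz : ∀ y, u y ≤ u z) {x y : Rd d}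
    (hxy : ‖x - z‖ = ‖y - z‖) : u y ≤ u x := by
  rcases eq_or_ne y z with rfl | hyz
  · rw [sub_self, norm_zero, norm_eq_zero, sub_eq_zero] at hxy
    rw [hxy]
  have hyz' : 0 < ‖y - z‖ := norm_pos_iff.2 (sub_ne_zero.2 hyz)
  have hu := h.cont
  have hc : Tendsto (fun t : ℝ => u (z + t • (x - z))) (𝓝[<] 1) (𝓝 (u (z + (1 : ℝ) • (x - z)))) := by
    have : Continuous fun t : ℝ => u (z + t • (x - z)) := by fun_prop
    exact this.continuousAt.tendsto.mono_left nhdsWithin_le_nhds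
  rw [one_smul, add_sub_cancel] at hc
  refine ge_of_tendsto hc ?_
  filter_upwards [Ioo_mem_nhdsLT (zero_lt_one (α := ℝ))] with t ht
  refine (h.lt_of_norm_lt hd ht₀ hmono hz ?_).le
  rw [add_sub_cancel_left, norm_smul, Real.norm_of_nonneg ht.1.le, hxy]
  exact mul_lt_of_lt_one_left hyz' ht.2

end PosSol

end PsiSetting

/-- **Corollary** (to Theorem 2.4): any nonnegative continuous solution of
`Ψ(−Δ)u = f(u)` in `ℝ^d` decaying at infinity, where `f ∈ C^{0,1}((0,∞))` is
non-increasing near `0`, is radially symmetric up to translation; moreover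
either `u ≡ 0` or (up to translation) `u` is strictly radially decreasing. -/
theorem radial_symmetry_entire
    {d : ℕ} (hd : 2 ≤ d) (S : PsiSetting d) (hker : S.kernelCond)
    (f : ℝ → ℝ) (hf : ∃ L : ℝ≥0, LipschitzOnWith L f (Set.Ioi 0))
    (t₀ : ℝ) (ht₀ : 0 < t₀) (hmono : AntitoneOn f (Set.Ioc 0 t₀))
    (u : Rd d → ℝ) (hu : Continuous u) (hnonneg : ∀ x, 0 ≤ u x)
    (hsol : IsSol S (Set.univ) (fun _ => 0) (fun x => f (u x)) u)
    (hdecay : Filter.Tendsto u (Filter.cocompact (Rd d)) (nhds 0)) :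
    ∃ z : Rd d, (∀ x y : Rd d, ‖x - z‖ = ‖y - z‖ → u x = u y) ∧
      ((∀ x, u x = 0) ∨ (∀ x y : Rd d, ‖x - z‖ < ‖y - z‖ → u y < u x)) := by
  obtain ⟨z, hz⟩ := PsiSetting.exists_forall_le_max hu hnonneg hdecay
  have hM : ∀ y, |u y| ≤ u z := fun y => by rw [abs_of_nonneg (hnonneg y)]; exact hz y
  have hsup := hsol.2.parabolicSuper hd hu hM
  have hsub := hsol.1.parabolicSuper hd hu hM
  by_cases hne : ∃ y, u y ≠ 0
  · have h : PsiSetting.PosSol S f u :=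
      ⟨hu, hsup.pos hd hsub hu hnonneg hdecay ht₀ hmono hne, hdecay, hsup, hsub, hf⟩
    exact ⟨z, fun x y hxy => (h.le_of_norm_eq hd ht₀ hmono hz hxy.symm).antisymm
      (h.le_of_norm_eq hd ht₀ hmono hz hxy), Or.inr fun x y hxy => h.lt_of_norm_lt hd ht₀ hmono hz hxy⟩
  · push Not at hne
    exact ⟨0, fun x y _ => by rw [hne, hne], Or.inl hne⟩
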